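/- Let F be an algebraically closed field of characteristic 2, and let X ≤ A_n be a subgroup isomorphic to A_m acting primitively on Ω = {1,…,n}, where n > m ≥ 9. Then for every F A_n-module V with dim_F V > 1, the restriction of V to X is a reducible F X-module. -/

import Mathlib

/-- A submodule is invariant under a representation. -/
def RepInvariant {F G V : Type*} [Field F] [Monoid G] [AddCommGroup V] [Module F V]
    (ρ : Representation F G V) (p : Submodule F V) : Prop :=
  ∀ g : G, ∀ v ∈ p, ρ g v ∈ p

/-- A representation is irreducible if the space is nonzero and the only invariant
submodules are `⊥` and `⊤`. -/
def RepIrreducible {F G V : Type*} [Field F] [Monoid G] [AddCommGroup V] [Module F V]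
    (ρ : Representation F G V) : Prop :=
  Nontrivial V ∧ ∀ p : Submodule F V, RepInvariant ρ p → p = ⊥ ∨ p = ⊤

/-- A primitive permutation action: transitive and all blocks are trivial. -/
def IsPrimitiveAction (G α : Type*) [Group G] [MulAction G α] : Prop :=
  MulAction.IsPretransitive G α ∧
    ∀ B : Set α, MulAction.IsBlock G B → B.Subsingleton ∨ B = Set.univ

open Equiv Equiv.Perm in
/-- The permutation `a ↦ b ↦ c ↦ a` (for distinct `a, b, c`). -/
def threeCycle {α : Type*} [DecidableEq α] (a b c : α) : Equiv.Perm α :=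
  Equiv.swap a b * Equiv.swap b c

namespace threeCycle

open Equiv Equiv.Perm

variable {α : Type*} [DecidableEq α]

theorem conj (g : Perm α) (a b c : α) :
    g * threeCycle a b c * g⁻¹ = threeCycle (g a) (g b) (g c) := by
  simp only [threeCycle, swap_apply_apply]
  group

theorem inv_eq (a b c : α) : (threeCycle a b c)⁻¹ = threeCycle c b a := by
  simp [threeCycle, swap_comm]

theorem rotate {a b c : α} (hab : a ≠ b) (hbc : b ≠ c) (hac : a ≠ c) :
    threeCycle a b c = threeCycle b c a := by
  ext x
  simp only [threeCycle, Perm.mul_apply, swap_apply_def]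
  split_ifs <;> simp_all

theorem isThreeCycle [Fintype α] {a b c : α} (hab : a ≠ b) (hbc : b ≠ c) (hac : a ≠ c) :
    (threeCycle a b c).IsThreeCycle := by
  rw [threeCycle, swap_comm a b]
  exact isThreeCycle_swap_mul_swap_same hab.symm hbc hac

theorem mem_alternatingGroup [Fintype α] {a b c : α} (hab : a ≠ b) (hbc : b ≠ c) :
    threeCycle a b c ∈ alternatingGroup α := by
  simp [Equiv.Perm.mem_alternatingGroup, threeCycle, sign_swap hab, sign_swap hbc]

theorem apply_left {a b c : α} (hab : a ≠ b) (hac : a ≠ c) : threeCycle a b c a = b := by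
  simp [threeCycle, swap_apply_of_ne_of_ne hab hac]

theorem apply_mid {a b c : α} (hbc : b ≠ c) (hac : a ≠ c) : threeCycle a b c b = c := by
  simp [threeCycle, swap_apply_of_ne_of_ne hac.symm hbc.symm]

theorem apply_right (a b c : α) : threeCycle a b c c = a := by
  simp [threeCycle]

theorem apply_of_ne {a b c x : α} (ha : x ≠ a) (hb : x ≠ b) (hc : x ≠ c) :
    threeCycle a b c x = x := by
  simp [threeCycle, swap_apply_of_ne_of_ne, *]

end threeCycle

/-- Two points are linked by a permutation group if they are equal or
occur in a common 3-cycle of the group. -/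
def Linked {α : Type*} [DecidableEq α] (K : Subgroup (Equiv.Perm α)) (a b : α) : Prop :=
  a = b ∨ ∃ c, a ≠ b ∧ b ≠ c ∧ a ≠ c ∧ threeCycle a b c ∈ K

namespace Linked

open Equiv Equiv.Perm

variable {α : Type*} [DecidableEq α] {K : Subgroup (Perm α)} {a b c : α}

theorem refl (a : α) : Linked K a a := Or.inl rfl

theorem map {g : Perm α} (hg : g ∈ K) (h : Linked K a b) : Linked K (g a) (g b) := by
  rcases h with rfl | ⟨c, hab, hbc, hac, h⟩
  · exact .refl _
  · refine Or.inr ⟨g c, g.injective.ne hab, g.injective.ne hbc, g.injective.ne hac, ?_⟩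
    rw [← threeCycle.conj]
    exact K.mul_mem (K.mul_mem hg h) (K.inv_mem hg)

theorem symm (h : Linked K a b) : Linked K b a := by
  rcases h with rfl | ⟨c, hab, hbc, hac, h⟩
  · exact .refl _
  · refine Or.inr ⟨c, hab.symm, hac, hbc, ?_⟩
    rw [← threeCycle.rotate hbc.symm hab.symm hac.symm, ← threeCycle.inv_eq]
    exact K.inv_mem h

theorem of_mem (hab : a ≠ b) (hbc : b ≠ c) (hac : a ≠ c) (h : threeCycle a b c ∈ K) :
    Linked K a b := Or.inr ⟨c, hab, hbc, hac, h⟩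

theorem trans {d : α} (hab : Linked K a b) (hbd : Linked K b d) : Linked K a d := by
  rcases hab with rfl | ⟨c, hab, hbc, hac, h⟩
  · exact hbd
  rcases hbd with rfl | ⟨e, hbd, hde, hbe, h'⟩
  · exact Or.inr ⟨c, hab, hbc, hac, h⟩
  by_cases had : a = d
  · exact had ▸ .refl _
  by_cases hae : a = e
  · subst hae
    exact (of_mem hde hab hbd.symm (threeCycle.rotate hbd hde hbe ▸ h')).symm
  · have := map h' (of_mem hab hbc hac h)
    rwa [threeCycle.apply_left hbd hbe, threeCycle.apply_of_ne hab had hae] at this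

open scoped Pointwise in
theorem alternatingGroup_le [Fintype α] (hcard : 3 ≤ Fintype.card α) (h : ∀ a b, Linked K a b) :
    alternatingGroup α ≤ K := by
  have key : ∀ {a b : α}, a ≠ b → ∃ c, b ≠ c ∧ a ≠ c ∧ threeCycle a b c ∈ K := by
    intro a b hab
    rcases h a b with h | ⟨c, -, h⟩
    · exact absurd h hab
    · exact ⟨c, h⟩
  obtain ⟨a, b, hab⟩ : ∃ a b : α, a ≠ b := by
    have : Nontrivial α := Fintype.one_lt_card_iff_nontrivial.mp (by omega)
    exact exists_pair_ne α
  obtain ⟨c, hbc, hac, hc⟩ := key hab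
  refine alternatingGroup_le_of_isPreprimitive_of_isThreeCycle_mem ?_
    (threeCycle.isThreeCycle hab hbc hac) hc
  have htrans : MulAction.IsPretransitive K α := by
    refine ⟨fun x y => ?_⟩
    by_cases hxy : x = y
    · exact ⟨1, by simpa using hxy⟩
    obtain ⟨z, hyz, hxz, hz⟩ := key hxy
    exact ⟨⟨_, hz⟩, threeCycle.apply_left hxy hxz⟩
  refine { isTrivialBlock_of_isBlock := fun {B} hB => ?_ }
  by_contra hcon
  simp only [MulAction.IsTrivialBlock, not_or, Set.not_subsingleton_iff] at hcon
  obtain ⟨⟨x, hx, y, hy, hxy⟩, hu⟩ := hcon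
  obtain ⟨z, hz⟩ := (Set.ne_univ_iff_exists_notMem B).mp hu
  have hxz : x ≠ z := fun h => hz (h ▸ hx)
  have hyz : y ≠ z := fun h => hz (h ▸ hy)
  obtain ⟨w, hzw, hxw, hw⟩ := key hxz
  have hzB : z ∈ (⟨_, hw⟩ : K) • B := ⟨x, hx, threeCycle.apply_left hxz hxw⟩
  have hne : (⟨_, hw⟩ : K) • B ≠ B := fun h => hz (h ▸ hzB)
  have hdisj := (MulAction.isBlock_iff_smul_eq_or_disjoint.mp hB ⟨_, hw⟩).resolve_left hne
  by_cases hyw : y = w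
  · subst hyw
    exact Set.disjoint_left.mp hdisj (Set.mem_smul_set.mpr ⟨y, hy, threeCycle.apply_right x z y⟩) hx
  · exact Set.disjoint_left.mp hdisj (Set.mem_smul_set.mpr
      ⟨y, hy, threeCycle.apply_of_ne hxy.symm hyz hyw⟩) hy

end Linked

theorem choose_two_le_choose {N j : ℕ} (h2 : 2 ≤ j) (hj : j + 2 ≤ N) :
    N.choose 2 ≤ N.choose j := by
  induction N generalizing j with
  | zero => omega
  | succ N ih =>
    rcases h2.eq_or_lt with rfl | h3
    · rfl
    obtain ⟨i, rfl⟩ : ∃ i, j = i + 1 := ⟨j - 1, by omega⟩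
    rcases hj.eq_or_lt with h | h
    · have : N = i + 2 := by omega
      subst this
      rw [Nat.choose_symm_of_eq_add (show i + 2 + 1 = 2 + (i + 1) by omega)]
    · have h1 := ih (j := i) (by omega) (by omega)
      have h2 := ih (j := i + 1) (by omega) (by omega)
      rw [Nat.choose_succ_succ' N i, Nat.choose_succ_succ' N 1, Nat.choose_one_right]
      have : N ≤ N.choose 2 := by
        rw [Nat.choose_two_right, Nat.le_div_iff_mul_le (by norm_num)]
        exact Nat.mul_le_mul_left _ (by omega)
      change N + N.choose 2 ≤ _
      omega

section OrbitCount

open Equiv Equiv.Perm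
open scoped Pointwise

variable {α : Type*} [Fintype α] [DecidableEq α]

/-- The setwise stabilizer of a finset inside a permutation group. -/
def setStab (K : Subgroup (Perm α)) (C : Finset α) : Subgroup (Perm α) :=
  MulAction.stabilizer (Perm α) C ⊓ K

omit [Fintype α] in
theorem card_orbit_mul_card_setStab (K : Subgroup (Perm α)) (C : Finset α) :
    Nat.card (MulAction.orbit K C) * Nat.card (setStab K C) = Nat.card K := by
  have h1 : Nat.card (MulAction.stabilizer K C) = Nat.card (setStab K C) := by
    have : MulAction.stabilizer K C = (setStab K C).subgroupOf K := by
      ext g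
      simp [setStab, Subgroup.mem_subgroupOf, MulAction.mem_stabilizer_iff, Subgroup.smul_def]
    rw [this]
    exact Nat.card_congr (Subgroup.subgroupOfEquivOfLe inf_le_right).toEquiv
  rw [← h1, ← Nat.card_prod, Nat.card_congr (MulAction.orbitProdStabilizerEquivGroup K C)]

theorem exists_mem_alternatingGroup_smul_eq {C D : Finset α} (h : C.card = D.card)
    (hC : C.card + 2 ≤ Fintype.card α) : ∃ g ∈ alternatingGroup α, g • C = D := by
  have e : {x // x ∈ C} ≃ {x // x ∈ D} := Fintype.equivOfCardEq (by simpa using h)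
  let g : Perm α := e.extendSubtype
  have hg : g • C = D := by
    refine Finset.eq_of_subset_of_card_le ?_ (by simp [h])
    intro x hx
    obtain ⟨y, hy, rfl⟩ := Finset.mem_smul_finset.mp hx
    exact e.extendSubtype_mem y hy
  rcases Int.units_eq_one_or (sign g) with h1 | h1
  · exact ⟨g, h1, hg⟩
  · have : 1 < (Cᶜ).card := by rw [Finset.card_compl]; omega
    obtain ⟨x, hx, y, hy, hxy⟩ := Finset.one_lt_card.mp this
    rw [Finset.mem_compl] at hx hy
    refine ⟨g * swap x y, by simp [mem_alternatingGroup, h1, sign_swap hxy], ?_⟩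
    rw [mul_smul, ← hg]
    congr 1
    refine Finset.eq_of_subset_of_card_le ?_ (by simp)
    intro z hz
    obtain ⟨w, hw, rfl⟩ := Finset.mem_smul_finset.mp hz
    rw [Perm.smul_def, swap_apply_of_ne_of_ne (by rintro rfl; exact hx hw)
      (by rintro rfl; exact hy hw)]
    exact hw

theorem card_orbit_alternatingGroup {C : Finset α} (hC : C.card + 2 ≤ Fintype.card α) :
    Nat.card (MulAction.orbit (alternatingGroup α) C) = (Fintype.card α).choose C.card := by
  have : MulAction.orbit (alternatingGroup α) C =
      (Finset.powersetCard C.card (Finset.univ : Finset α) : Set (Finset α)) := by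
    ext D
    simp only [Finset.mem_coe,
      Finset.mem_powersetCard, Finset.subset_univ, true_and]
    constructor
    · rintro ⟨g, rfl⟩
      simp
    · intro h
      obtain ⟨g, hg, hgC⟩ := exists_mem_alternatingGroup_smul_eq h.symm hC
      exact ⟨⟨g, hg⟩, hgC⟩
  rw [this]
  simp [Nat.card_eq_fintype_card]

theorem mul_card_orbit_mul_card_setStab {K : Subgroup (Perm α)} {n : ℕ}
    (hn : n * Nat.card K = Nat.card (alternatingGroup α)) {C : Finset α}
    (hC : C.card + 2 ≤ Fintype.card α) :
    n * Nat.card (MulAction.orbit K C) * Nat.card (setStab K C) =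
      (Fintype.card α).choose C.card * Nat.card (setStab (alternatingGroup α) C) := by
  rw [← card_orbit_alternatingGroup hC, card_orbit_mul_card_setStab, ← hn,
    ← card_orbit_mul_card_setStab K C, mul_assoc]

end OrbitCount

section LinkClass

open Equiv Equiv.Perm
open scoped Pointwise

variable {α : Type*} [Fintype α] [DecidableEq α]

open Classical in
/-- The set of points linked to a given point. -/
noncomputable def linkClass (K : Subgroup (Perm α)) (a : α) : Finset α :=
  Finset.univ.filter (Linked K a)

variable {K : Subgroup (Perm α)}

theorem mem_linkClass {a b : α} : b ∈ linkClass K a ↔ Linked K a b := by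
  simp [linkClass]

theorem self_mem_linkClass (a : α) : a ∈ linkClass K a := mem_linkClass.mpr (.refl a)

theorem linkClass_eq {a b : α} (h : Linked K a b) : linkClass K a = linkClass K b := by
  ext c
  rw [mem_linkClass, mem_linkClass]
  exact ⟨h.symm.trans, h.trans⟩

theorem smul_linkClass {g : Perm α} (hg : g ∈ K) (a : α) :
    g • linkClass K a = linkClass K (g a) := by
  ext c
  rw [mem_linkClass, ← Finset.inv_smul_mem_iff, mem_linkClass]
  constructor
  · intro h
    simpa using h.map hg
  · intro h
    simpa using h.map (K.inv_mem hg)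

theorem card_orbit_linkClass_mul_le (a : α) :
    Nat.card (MulAction.orbit K (linkClass K a)) * (linkClass K a).card ≤ Fintype.card α := by
  classical
  set S : Finset (Finset α) := (MulAction.orbit K (linkClass K a)).toFinset with hS
  have h1 : Nat.card (MulAction.orbit K (linkClass K a)) = S.card := by
    rw [hS, Set.toFinset_card, Nat.card_eq_fintype_card]
  have hmem : ∀ D ∈ S, ∃ g ∈ K, D = linkClass K (g a) := by
    intro D hD
    rw [hS, Set.mem_toFinset] at hD
    obtain ⟨g, rfl⟩ := hD
    exact ⟨g, g.2, smul_linkClass g.2 a⟩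
  rw [h1, ← smul_eq_mul, ← Finset.sum_const]
  calc ∑ _D ∈ S, (linkClass K a).card = ∑ D ∈ S, D.card := by
        refine Finset.sum_congr rfl fun D hD => ?_
        obtain ⟨g, hg, rfl⟩ := hmem D hD
        rw [← smul_linkClass hg, Finset.card_smul_finset]
    _ = (S.biUnion id).card := by
        refine (Finset.card_biUnion ?_).symm
        intro D hD E hE hDE
        obtain ⟨g, hg, rfl⟩ := hmem D hD
        obtain ⟨h, hh, rfl⟩ := hmem E hE
        change Disjoint (linkClass K (g a)) (linkClass K (h a))
        rw [Finset.disjoint_left]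
        intro x hx hx'
        rw [mem_linkClass] at hx hx'
        exact hDE (linkClass_eq (hx.trans hx'.symm))
    _ ≤ Fintype.card α := Finset.card_le_univ _

theorem three_le_card_linkClass {a b c : α} (hab : a ≠ b) (hbc : b ≠ c) (hac : a ≠ c)
    (h : threeCycle a b c ∈ K) : 3 ≤ (linkClass K a).card := by
  have h1 : Linked K a b := .of_mem hab hbc hac h
  have h2 : Linked K b c := .of_mem hbc hac.symm hab.symm (threeCycle.rotate hab hbc hac ▸ h)
  rw [show 3 = ({a, b, c} : Finset α).card by simp [*]]
  refine Finset.card_le_card ?_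
  intro x hx
  simp only [Finset.mem_insert, Finset.mem_singleton] at hx
  rw [mem_linkClass]
  rcases hx with rfl | rfl | rfl
  exacts [.refl _, h1, h1.trans h2]

omit [Fintype α] in
theorem card_le_card_smul_inter_threeCycle {x y z : α} (hxy : x ≠ y) (hyz : y ≠ z) (hxz : x ≠ z)
    (B : Finset α) : B.card ≤ (threeCycle x y z • B ∩ B).card + 1 := by
  set t := threeCycle x y z with ht
  have h1 : (t • B \ B).card ≤ 1 := by
    rw [Finset.card_le_one]
    have hx : t x = y := threeCycle.apply_left hxy hxz
    have hy : t y = z := threeCycle.apply_mid hyz hxz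
    have hz : t z = x := threeCycle.apply_right x y z
    have hB : ∀ u ∈ B, t u ∉ B → u = x ∨ u = y ∨ u = z := by
      intro u hu htu
      by_contra hcon
      push Not at hcon
      rw [ht, threeCycle.apply_of_ne hcon.1 hcon.2.1 hcon.2.2] at htu
      exact htu hu
    intro u hu v hv
    rw [Finset.mem_sdiff, Finset.mem_smul_finset] at hu hv
    obtain ⟨⟨u, huB, rfl⟩, hu⟩ := hu
    obtain ⟨⟨v, hvB, rfl⟩, hv⟩ := hv
    rw [Perm.smul_def] at hu hv ⊢
    rcases hB u huB hu with rfl | rfl | rfl <;> rcases hB v hvB hv with rfl | rfl | rfl <;>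
      simp_all
  have h2 := Finset.card_inter_add_card_sdiff (t • B) B
  rw [Finset.card_smul_finset] at h2
  omega

/-- If the complement of a maximal link class is handled suitably, the subgroup is not
doubly transitive on its cosets. -/
theorem not_double_coset_of_linkClass {a₀ : α}
    (hk : 3 ≤ (linkClass K a₀).card) (hk2 : (linkClass K a₀).card + 2 ≤ Fintype.card α)
    (hmax : ∀ b, (linkClass K b).card ≤ (linkClass K a₀).card) (hα : 7 ≤ Fintype.card α) :
    ∃ a ∈ alternatingGroup α, ∃ b ∈ alternatingGroup α, a ∉ K ∧ b ∉ K ∧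
      ¬ ∃ h ∈ K, ∃ h' ∈ K, a = h * b * h' := by
  set C := linkClass K a₀ with hC
  obtain ⟨x₁, hx₁, x₂, hx₂, hx⟩ := Finset.one_lt_card.mp (show 1 < C.card by omega)
  have hCc : Cᶜ.card + C.card = Fintype.card α := Finset.card_compl_add_card C
  have hY : ∃ y₁ ∉ C, ∃ y₂ ∉ C, y₁ ≠ y₂ ∧ (C.card = 3 → ¬ Linked K y₁ y₂) := by
    by_cases h3 : C.card = 3
    · obtain ⟨y₁, hy₁⟩ : (Cᶜ).Nonempty := Finset.card_pos.mp (by omega)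
      obtain ⟨y₂, hy₂, hn⟩ := Finset.exists_mem_notMem_of_card_lt_card
        (show (linkClass K y₁).card < (Cᶜ).card by have := hmax y₁; omega)
      rw [mem_linkClass] at hn
      refine ⟨y₁, by simpa using hy₁, y₂, by simpa using hy₂, ?_, fun _ => hn⟩
      rintro rfl
      exact hn (.refl _)
    · obtain ⟨y₁, hy₁, y₂, hy₂, hy⟩ := Finset.one_lt_card.mp (show 1 < Cᶜ.card by omega)
      exact ⟨y₁, by simpa using hy₁, y₂, by simpa using hy₂, hy, fun h => absurd h h3⟩
  obtain ⟨y₁, hy₁, y₂, hy₂, hy, hlink⟩ := hY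
  have hxy : ∀ {x y}, x ∈ C → y ∉ C → x ≠ y := fun hx hy h => hy (h ▸ hx)
  have h11 := hxy hx₁ hy₁
  have h12 := hxy hx₁ hy₂
  have h21 := hxy hx₂ hy₁
  have h22 := hxy hx₂ hy₂
  set a := swap x₁ y₁ * swap x₂ y₂ with ha
  have haC : a • C ⊆ (C \ {x₁, x₂}) ∪ {y₁, y₂} := by
    intro u hu
    obtain ⟨v, hv, rfl⟩ := Finset.mem_smul_finset.mp hu
    rw [Perm.smul_def, ha, Perm.mul_apply]
    have hv1 := hxy hv hy₁
    have hv2 := hxy hv hy₂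
    by_cases e1 : v = x₁
    · subst e1
      rw [swap_apply_of_ne_of_ne hx h12, swap_apply_left]; simp
    by_cases e2 : v = x₂
    · subst e2
      rw [swap_apply_left, swap_apply_of_ne_of_ne h12.symm hy.symm]; simp
    rw [swap_apply_of_ne_of_ne e2 hv2, swap_apply_of_ne_of_ne e1 hv1]
    simp [hv, e1, e2]
  have hsmall : ∀ b, (a • C ∩ linkClass K b).card + 2 ≤ C.card := by
    intro b
    have hpair : (C \ {x₁, x₂}).card + 2 = C.card := by
      rw [← Finset.card_sdiff_add_card_eq_card (s := {x₁, x₂}) (t := C), Finset.card_pair hx]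
      intro u hu
      rcases Finset.mem_insert.mp hu with rfl | hu
      · exact hx₁
      · exact Finset.mem_singleton.mp hu ▸ hx₂
    by_cases hb : Linked K a₀ b
    · rw [← linkClass_eq hb, ← hC, ← hpair]
      refine Nat.add_le_add_right (Finset.card_le_card ?_) 2
      intro u hu
      obtain ⟨hu1, hu2⟩ := Finset.mem_inter.mp hu
      have := haC hu1
      simp only [Finset.mem_union, Finset.mem_sdiff, Finset.mem_insert,
        Finset.mem_singleton] at this ⊢
      rcases this with h | rfl | rfl
      exacts [h, absurd hu2 hy₁, absurd hu2 hy₂]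
    · have hsub : a • C ∩ linkClass K b ⊆ {y₁, y₂} := by
        intro u hu
        obtain ⟨hu1, hu2⟩ := Finset.mem_inter.mp hu
        have := haC hu1
        rw [Finset.mem_union, Finset.mem_sdiff] at this
        rcases this with h | h
        · exact absurd ((mem_linkClass.mp h.1).trans (mem_linkClass.mp hu2).symm) hb
        · exact h
      have h2 := Finset.card_le_card hsub
      rw [Finset.card_pair hy] at h2
      by_cases h3 : C.card = 3
      · have : (a • C ∩ linkClass K b).card ≠ 2 := by
          intro h
          have heq := Finset.eq_of_subset_of_card_le hsub (by rw [Finset.card_pair hy, h])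
          have m1 : y₁ ∈ a • C ∩ linkClass K b := by rw [heq]; simp
          have m2 : y₂ ∈ a • C ∩ linkClass K b := by rw [heq]; simp
          exact hlink h3 ((mem_linkClass.mp (Finset.mem_inter.mp m1).2).symm.trans
            (mem_linkClass.mp (Finset.mem_inter.mp m2).2))
        omega
      · omega
  refine ⟨a, ?_, threeCycle x₁ y₁ y₂, threeCycle.mem_alternatingGroup h11 hy, ?_, ?_, ?_⟩
  · simp [mem_alternatingGroup, ha, sign_swap h11, sign_swap h22]
  · intro haK
    have := hsmall (a a₀)
    rw [← smul_linkClass haK, ← hC, Finset.inter_self, Finset.card_smul_finset] at this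
    omega
  · intro htK
    exact hy₁ (mem_linkClass.mpr ((mem_linkClass.mp hx₁).trans (.of_mem h11 hy h12 htK)))
  · rintro ⟨h, hh, h', hh', hab⟩
    have h1 := card_le_card_smul_inter_threeCycle h11 hy h12 (h' • C)
    have h2 := hsmall (h (h' a₀))
    rw [hC, ← smul_linkClass hh, ← smul_linkClass hh', ← hC, hab, mul_smul, mul_smul,
      ← Finset.smul_finset_inter, Finset.card_smul_finset] at h2
    rw [Finset.card_smul_finset] at h1
    omega

end LinkClass

section CaseThreeCycle

open Equiv Equiv.Perm
open scoped Pointwise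

variable {α : Type*} [Fintype α] [DecidableEq α] {K : Subgroup (Perm α)} {n : ℕ}

/-- The conclusion about a maximal subgroup of the alternating group: its index is large and
the action on its cosets is not doubly transitive. -/
def LargeNotDoublyTransitive (K : Subgroup (Perm α)) (n : ℕ) : Prop :=
  (Fintype.card α - 1).choose 2 ≤ n ∧ (Fintype.card α = 9 → 29 ≤ n) ∧
    ∃ a ∈ alternatingGroup α, ∃ b ∈ alternatingGroup α, a ∉ K ∧ b ∉ K ∧
      ¬ ∃ h ∈ K, ∃ h' ∈ K, a = h * b * h'

theorem card_linkClass_add_two_le (hα : 9 ≤ Fintype.card α) (hKA : K ≤ alternatingGroup α)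
    (hne : ¬ alternatingGroup α ≤ K)
    (hcoatom : ∀ L, K ≤ L → L ≤ alternatingGroup α → L = K ∨ L = alternatingGroup α)
    (hn : n * Nat.card K = Nat.card (alternatingGroup α)) (hnα : n ≠ Fintype.card α) {a₀ : α}
    (hk : 3 ≤ (linkClass K a₀).card) : (linkClass K a₀).card + 2 ≤ Fintype.card α := by
  by_contra hcon
  have hle := Finset.card_le_univ (linkClass K a₀)
  by_cases h0 : (linkClass K a₀).card = Fintype.card α
  · refine hne (Linked.alternatingGroup_le (by omega) fun a b => ?_)
    have hall : ∀ x, Linked K a₀ x := fun x => by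
      rw [← mem_linkClass, Finset.card_eq_iff_eq_univ _ |>.mp h0]; simp
    exact (hall a).symm.trans (hall b)
  have h1 : ((linkClass K a₀)ᶜ).card = 1 := by rw [Finset.card_compl]; omega
  obtain ⟨p, hp⟩ := Finset.card_eq_one.mp h1
  have hmem : ∀ x, Linked K a₀ x ↔ x ≠ p := by
    intro x
    rw [← mem_linkClass, ← Finset.notMem_compl, hp, Finset.mem_singleton]
  have hfix : ∀ g ∈ K, g p = p := by
    intro g hg
    by_contra hgp
    have h2 := (hmem _).mpr hgp
    have h3 : linkClass K p ⊆ {p} := by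
      intro x hx
      rw [Finset.mem_singleton]
      by_contra hxp
      exact (hmem p).mp (((hmem x).mpr hxp).trans (mem_linkClass.mp hx).symm) rfl
    have h4 := Finset.card_le_card h3
    rw [← Finset.card_smul_finset g, smul_linkClass hg, ← linkClass_eq h2] at h4
    simp at h4
    omega
  have hL := hcoatom (setStab (alternatingGroup α) {p})
    (fun g hg => ⟨by simp [MulAction.mem_stabilizer_iff, hfix g hg], hKA hg⟩) inf_le_right
  have hcard := card_orbit_mul_card_setStab (alternatingGroup α) {p}
  rw [card_orbit_alternatingGroup (by simp; omega)] at hcard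
  simp only [Finset.card_singleton, Nat.choose_one_right] at hcard
  rcases hL with hL | hL
  · rw [hL, ← hn] at hcard
    exact hnα (Nat.eq_of_mul_eq_mul_right Nat.card_pos hcard).symm
  · rw [hL] at hcard
    have := Nat.eq_of_mul_eq_mul_right (Nat.card_pos (α := alternatingGroup α))
      (hcard.trans (one_mul _).symm)
    omega

theorem largeNotDoublyTransitive_of_threeCycle_mem (hα : 9 ≤ Fintype.card α)
    (hKA : K ≤ alternatingGroup α) (hne : ¬ alternatingGroup α ≤ K)
    (hcoatom : ∀ L, K ≤ L → L ≤ alternatingGroup α → L = K ∨ L = alternatingGroup α)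
    (hn : n * Nat.card K = Nat.card (alternatingGroup α)) (hnα : n ≠ Fintype.card α)
    {x y z : α} (hxy : x ≠ y) (hyz : y ≠ z) (hxz : x ≠ z) (ht : threeCycle x y z ∈ K) :
    LargeNotDoublyTransitive K n := by
  obtain ⟨a₀, -, hmax⟩ := Finset.exists_max_image Finset.univ
    (fun a => (linkClass K a).card) ⟨x, Finset.mem_univ x⟩
  simp only [Finset.mem_univ, true_implies] at hmax
  have hk : 3 ≤ (linkClass K a₀).card := (three_le_card_linkClass hxy hyz hxz ht).trans (hmax x)
  have hk2 := card_linkClass_add_two_le hα hKA hne hcoatom hn hnα hk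
  have hcount := mul_card_orbit_mul_card_setStab hn hk2
  have hr := card_orbit_linkClass_mul_le (K := K) a₀
  have hle : setStab K (linkClass K a₀) ≤ setStab (alternatingGroup α) (linkClass K a₀) :=
    inf_le_inf_left _ hKA
  have hdvd := Subgroup.card_dvd_of_le hle
  have hpos : 0 < Nat.card (setStab K (linkClass K a₀)) := Nat.card_pos
  have hposA : 0 < Nat.card (setStab (alternatingGroup α) (linkClass K a₀)) := Nat.card_pos
  have hsle := Nat.le_of_dvd hposA hdvd
  have hchoose : (Fintype.card α).choose (linkClass K a₀).card ≤
      n * Nat.card (MulAction.orbit K (linkClass K a₀)) := by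
    refine Nat.le_of_mul_le_mul_right ?_ hpos
    rw [hcount]
    exact Nat.mul_le_mul_left _ hsle
  refine ⟨?_, ?_, not_double_coset_of_linkClass hk hk2 hmax (by omega)⟩
  · obtain ⟨j, hj⟩ : ∃ j, (linkClass K a₀).card = j + 1 := ⟨(linkClass K a₀).card - 1, by omega⟩
    obtain ⟨N, hN⟩ : ∃ N, Fintype.card α = N + 1 := ⟨Fintype.card α - 1, by omega⟩
    rw [hj] at hk hk2 hr hchoose
    rw [hN] at hk2 hr hchoose ⊢
    rw [Nat.add_sub_cancel]
    refine (choose_two_le_choose (N := N) (j := j) (by omega) (by omega)).trans ?_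
    refine Nat.le_of_mul_le_mul_left ?_ N.succ_pos
    change (N + 1) * _ ≤ (N + 1) * _
    rw [Nat.add_one_mul_choose_eq]
    calc _ ≤ n * Nat.card (MulAction.orbit K (linkClass K a₀)) * (j + 1) :=
          Nat.mul_le_mul_right _ hchoose
      _ ≤ (N + 1) * n := by
        rw [mul_assoc, mul_comm]
        exact Nat.mul_le_mul_right _ hr
  · intro h9
    by_cases h3 : (linkClass K a₀).card = 3
    · have hneq : setStab K (linkClass K a₀) ≠ setStab (alternatingGroup α) (linkClass K a₀) := by
        intro heq
        have : 3 < ((linkClass K a₀)ᶜ).card := by rw [Finset.card_compl]; omega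
        obtain ⟨u, hu⟩ : ((linkClass K a₀)ᶜ).Nonempty := Finset.card_pos.mp (by omega)
        obtain ⟨v, hv, hvn⟩ := Finset.exists_mem_notMem_of_card_lt_card
          (show (linkClass K u).card < ((linkClass K a₀)ᶜ).card by have := hmax u; omega)
        have huv : u ≠ v := by
          rintro rfl
          exact hvn (self_mem_linkClass _)
        obtain ⟨w, hw, hwn⟩ := Finset.exists_mem_notMem_of_card_lt_card
          (show ({u, v} : Finset α).card < ((linkClass K a₀)ᶜ).card by
            rw [Finset.card_pair huv]; omega)
        simp only [Finset.mem_insert, Finset.mem_singleton, not_or] at hwn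
        rw [Finset.mem_compl] at hu hv hw
        obtain ⟨hwu, hwv⟩ : u ≠ w ∧ v ≠ w := ⟨Ne.symm hwn.1, Ne.symm hwn.2⟩
        have hmem : threeCycle u v w ∈ setStab (alternatingGroup α) (linkClass K a₀) := by
          refine ⟨?_, threeCycle.mem_alternatingGroup huv hwv⟩
          refine MulAction.mem_stabilizer_iff.mpr
            (Finset.eq_of_subset_of_card_le ?_ (by rw [Finset.card_smul_finset]))
          intro s hs
          obtain ⟨s, hs', rfl⟩ := Finset.mem_smul_finset.mp hs
          rw [Perm.smul_def, threeCycle.apply_of_ne]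
          · exact hs'
          all_goals rintro rfl; contradiction
        rw [← heq] at hmem
        exact hvn (mem_linkClass.mpr (.of_mem huv hwv hwu hmem.2))
      have h2 : 2 * Nat.card (setStab K (linkClass K a₀)) ≤
          Nat.card (setStab (alternatingGroup α) (linkClass K a₀)) := by
        obtain ⟨e, he⟩ := hdvd
        have he0 : e ≠ 0 := by rintro rfl; simp at he; omega
        have he1 : e ≠ 1 := by
          rintro rfl
          rw [mul_one] at he
          exact hneq (Subgroup.eq_of_le_of_card_ge hle he.le)
        rw [he, mul_comm]
        exact Nat.mul_le_mul_left _ (by omega)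
      rw [h9, h3] at hcount
      rw [h9, h3] at hr
      have : 84 * 2 ≤ n * Nat.card (MulAction.orbit K (linkClass K a₀)) := by
        refine Nat.le_of_mul_le_mul_right ?_ hpos
        rw [hcount, mul_assoc]
        exact Nat.mul_le_mul_left 84 h2
      have hr' : Nat.card (MulAction.orbit K (linkClass K a₀)) ≤ 3 := by omega
      have := Nat.mul_le_mul_left n hr'
      omega
    · rw [h9] at hchoose hr hk2
      generalize (linkClass K a₀).card = k at *
      have hr' : Nat.card (MulAction.orbit K (linkClass K a₀)) ≤ 2 := by
        by_contra hcon
        have := Nat.mul_le_mul (show 3 ≤ Nat.card (MulAction.orbit K (linkClass K a₀)) by omega)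
          (show 4 ≤ k by omega)
        omega
      have := Nat.mul_le_mul_left n hr'
      obtain ⟨h4, h7⟩ : 4 ≤ k ∧ k ≤ 7 := by omega
      by_cases h7' : k = 7
      · subst h7'
        have hr'' : Nat.card (MulAction.orbit K (linkClass K a₀)) ≤ 1 := by omega
        have := Nat.mul_le_mul_left n hr''
        have h36 : Nat.choose 9 7 = 36 := by decide
        omega
      · have : 84 ≤ Nat.choose 9 k := by
          have : k ≤ 6 := by omega
          interval_cases k <;> decide
        omega

end CaseThreeCycle

section CaseNoThreeCycle

open Equiv Equiv.Perm

variable {α : Type*} [Fintype α] [DecidableEq α] {K : Subgroup (Perm α)} {n : ℕ}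

/-- A finset is a base for a permutation group if its pointwise stabilizer is trivial. -/
def IsBase (K : Subgroup (Perm α)) (D : Finset α) : Prop :=
  ∀ g ∈ K, (∀ x ∈ D, g x = x) → g = 1

omit [Fintype α] in
theorem commutator_eq_threeCycle {D : Finset α} {p : α} {x y : Perm α} (hpD : p ∈ D)
    (hx : ∀ u ∉ D, x u = u) (hy : ∀ u ∈ D, u ≠ p → y u = u) (hyp : y p ∉ D) (hxp : x p ≠ p) :
    x * y * x⁻¹ * y⁻¹ = threeCycle p (x p) (y p) := by
  rw [mul_inv_eq_iff_eq_mul, mul_inv_eq_iff_eq_mul]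
  have hxD : ∀ u ∈ D, x u ∈ D := fun u hu => by
    by_contra h
    exact h ((x.injective (hx _ h)).symm ▸ hu)
  have hpx : p ≠ x p := hxp.symm
  have hpy : p ≠ y p := fun h => hyp (h ▸ hpD)
  have hxy : x p ≠ y p := fun h => hyp (h ▸ hxD p hpD)
  ext u
  simp only [Perm.mul_apply]
  by_cases hu : u ∈ D
  · by_cases hup : u = p
    · rw [hup, hx _ hyp, hy _ (hxD p hpD) hxp, threeCycle.apply_mid hxy hpy]
    · rw [hy u hu hup]
      by_cases hxu : x u = p
      · rw [hxu, threeCycle.apply_right]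
      · rw [hy _ (hxD u hu) hxu, threeCycle.apply_of_ne hxu (x.injective.ne hup)]
        exact fun h => hyp (h ▸ hxD u hu)
  · rw [hx u hu]
    have hup : u ≠ p := fun h => hu (h ▸ hpD)
    by_cases hyu : y u = p
    · rw [hyu, threeCycle.apply_left hpx hpy]
    · have hyuD : y u ∉ D := fun h => hu (by rwa [y.injective (hy _ h hyu)] at h)
      rw [hx _ hyuD, threeCycle.apply_of_ne hyu (fun h => hyuD (h ▸ hxD p hpD))
        (y.injective.ne hup)]

theorem exists_isBase_two_mul_card_le
    (h3 : ∀ x y z, x ≠ y → y ≠ z → x ≠ z → threeCycle x y z ∉ K) :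
    ∃ D : Finset α, IsBase K D ∧ 2 * D.card ≤ Fintype.card α := by
  classical
  have huniv : IsBase K Finset.univ := fun g _ h => Perm.ext fun x => h x (Finset.mem_univ x)
  obtain ⟨D, hD, hmin⟩ := Finset.exists_min_image
    (Finset.univ.filter fun D : Finset α => IsBase K D) Finset.card
    ⟨Finset.univ, by simpa using huniv⟩
  simp only [Finset.mem_filter, Finset.mem_univ, true_and] at hD hmin
  refine ⟨D, hD, ?_⟩
  by_contra hcon
  have hnb : ∀ E : Finset α, E.card < D.card → ∃ g ∈ K, (∀ x ∈ E, g x = x) ∧ g ≠ 1 := by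
    intro E hE
    have := mt (hmin E) (by omega)
    simpa [IsBase] using this
  obtain ⟨x, hxK, hx, hx1⟩ := hnb Dᶜ (by rw [Finset.card_compl]; omega)
  simp only [Finset.mem_compl] at hx
  obtain ⟨p, hp⟩ : ∃ p, x p ≠ p := by
    by_contra! h
    exact hx1 (Perm.ext h)
  have hpD : p ∈ D := by
    by_contra h
    exact hp (hx p h)
  obtain ⟨y, hyK, hy, hy1⟩ := hnb (D.erase p) (Finset.card_erase_lt_of_mem hpD)
  have hy' : ∀ u ∈ D, u ≠ p → y u = u := fun u hu h => hy u (Finset.mem_erase.mpr ⟨h, hu⟩)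
  have hyp : y p ≠ p := by
    intro h
    refine hy1 (hD y hyK fun u hu => ?_)
    by_cases hup : u = p
    · rw [hup, h]
    · exact hy' u hu hup
  have hypD : y p ∉ D := fun h => hyp (y.injective (hy' _ h hyp))
  have hxpD : x p ∈ D := by
    by_contra h
    exact hp (x.injective (hx _ h))
  refine h3 p (x p) (y p) hp.symm (fun h => hypD (h ▸ hxpD)) hyp.symm ?_
  rw [← commutator_eq_threeCycle hpD hx hy' hypD hp]
  exact K.mul_mem (K.mul_mem (K.mul_mem hxK hyK) (K.inv_mem hxK)) (K.inv_mem hyK)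

theorem card_mul_factorial_le (hn : n * Nat.card K = Nat.card (alternatingGroup α))
    (hα : 1 < Fintype.card α) {D : Finset α} (hD : IsBase K D)
    (Z : Subgroup (Perm {x // x ∈ D})) (hZ : (Nat.card Z).Coprime (Nat.card K)) :
    Nat.card Z * (Fintype.card α - D.card).factorial ≤ 2 * n := by
  set φ := subtypeCongrHom (fun x => x ∈ D)
  have hφ : Function.Injective φ := subtypeCongrHom_injective _
  set Q : Subgroup (Perm α) := (Z.prod ⊤).map φ
  have hQ : Nat.card Q = Nat.card Z * (Fintype.card α - D.card).factorial := by
    rw [Nat.card_congr ((Z.prod ⊤).equivMapOfInjective φ hφ).symm.toEquiv,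
      Nat.card_congr (Subgroup.prodEquiv Z ⊤).toEquiv, Nat.card_prod, Subgroup.card_top,
      Nat.card_perm, Nat.card_eq_fintype_card (α := {x // ¬ x ∈ D}), Fintype.card_subtype_compl]
    simp
  have hdisj : Disjoint Q K := by
    rw [Subgroup.disjoint_def]
    rintro _ ⟨⟨a, b⟩, ⟨ha, -⟩, rfl⟩ hK
    have h1 : φ (a, b) ^ Nat.card Z = 1 := by
      refine hD _ (K.pow_mem hK _) fun x hx => ?_
      have haZ : a ^ Nat.card Z = 1 :=
        orderOf_dvd_iff_pow_eq_one.mp (Subgroup.orderOf_dvd_natCard Z ha)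
      rw [← map_pow, Prod.pow_mk, haZ]
      simp [φ, subtypeCongrHom, hx]
    have h2 : φ (a, b) ^ Nat.card K = 1 :=
      orderOf_dvd_iff_pow_eq_one.mp (Subgroup.orderOf_dvd_natCard K hK)
    have h3 := pow_gcd_eq_one.mpr ⟨h1, h2⟩
    rwa [hZ.gcd_eq_one, pow_one] at h3
  have hle : Nat.card Q * Nat.card K ≤ Nat.card (Perm α) := by
    rw [← Nat.card_prod]
    exact Nat.card_le_card_of_injective _ (Subgroup.mul_injective_of_disjoint hdisj)
  have : Nontrivial α := Fintype.one_lt_card_iff_nontrivial.mp hα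
  rw [← two_mul_nat_card_alternatingGroup, ← hn, hQ, ← mul_assoc] at hle
  exact Nat.le_of_mul_le_mul_right hle Nat.card_pos

theorem sub_one_dvd_card (hKA : K ≤ alternatingGroup α)
    (hn : n * Nat.card K = Nat.card (alternatingGroup α))
    (htrans : ∀ a ∈ alternatingGroup α, ∀ b ∈ alternatingGroup α, a ∉ K → b ∉ K →
      ∃ h ∈ K, ∃ h' ∈ K, a = h * b * h')
    (T : Finset (Perm α)) (hTA : ∀ t ∈ T, t ∈ alternatingGroup α) (hTK : ∀ t ∈ T, t ∉ K)
    (hconj : ∀ t ∈ T, ∀ g ∈ K, g * t * g⁻¹ ∈ T) : n - 1 ∣ T.card := by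
  classical
  rcases T.eq_empty_or_nonempty with rfl | ⟨t₀, ht₀⟩
  · simp
  set KF : Finset (Perm α) := Finset.univ.filter (· ∈ K) with hKF
  set S : Finset (Perm α) := Finset.univ.filter (fun g => g ∈ alternatingGroup α ∧ g ∉ K) with hS
  have hKc : KF.card = Nat.card K := by
    rw [hKF, Nat.card_eq_fintype_card, Fintype.card_subtype]
  have hSc : S.card = (n - 1) * Nat.card K := by
    have h1 : S = (Finset.univ.filter (· ∈ alternatingGroup α)) \ KF := by
      ext g; simp [hS, hKF]
    have h2 : KF ⊆ Finset.univ.filter (· ∈ alternatingGroup α) := fun g hg => by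
      simp only [hKF, Finset.mem_filter, Finset.mem_univ, true_and] at hg ⊢
      exact hKA hg
    rw [h1, Finset.card_sdiff_of_subset h2, hKc, Nat.sub_mul, hn, one_mul,
      Nat.card_eq_fintype_card (α := alternatingGroup α), Fintype.card_subtype]
  have key := Finset.card_mul_eq_card_mul (s := T) (t := S) (fun t a => a⁻¹ * t ∈ K)
    (m := Nat.card K) (n := (T.filter fun t => t₀⁻¹ * t ∈ K).card) ?_ ?_
  · rw [hSc] at key
    refine ⟨(T.filter fun t => t₀⁻¹ * t ∈ K).card, ?_⟩
    refine Nat.eq_of_mul_eq_mul_right (Nat.card_pos (α := K)) ?_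
    rw [key]; ring
  · intro t ht
    rw [← hKc]
    refine Finset.card_bij' (fun a _ => a⁻¹ * t) (fun k _ => t * k⁻¹) ?_ ?_ ?_ ?_
    · intro a ha
      simpa [hKF] using (Finset.mem_filter.mp ha).2
    · intro k hk
      have hk' : k ∈ K := by simpa [hKF] using hk
      simp only [Finset.bipartiteAbove, Finset.mem_filter, hS, Finset.mem_univ, true_and]
      refine ⟨⟨mul_mem (hTA t ht) (inv_mem (hKA hk')), fun h => hTK t ht ?_⟩, by simpa using hk'⟩
      simpa using K.mul_mem h hk'
    · intro a _; group
    · intro k _; group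
  · intro a ha
    simp only [hS, Finset.mem_filter, Finset.mem_univ, true_and] at ha
    obtain ⟨h, hh, h', hh', hab⟩ := htrans a ha.1 t₀ (hTA _ ht₀) ha.2 (hTK _ ht₀)
    refine Finset.card_bij' (fun t _ => h⁻¹ * t * h) (fun t _ => h * t * h⁻¹) ?_ ?_ ?_ ?_
    · intro t ht
      obtain ⟨ht, htK⟩ := Finset.mem_filter.mp ht
      refine Finset.mem_filter.mpr ⟨by simpa using hconj t ht _ (K.inv_mem hh), ?_⟩
      have : t₀⁻¹ * (h⁻¹ * t * h) = h' * (a⁻¹ * t) * h := by rw [hab]; group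
      rw [this]
      exact K.mul_mem (K.mul_mem hh' htK) hh
    · intro t ht
      obtain ⟨ht, htK⟩ := Finset.mem_filter.mp ht
      refine Finset.mem_filter.mpr ⟨hconj t ht _ hh, ?_⟩
      have : a⁻¹ * (h * t * h⁻¹) = h'⁻¹ * (t₀⁻¹ * t) * h⁻¹ := by rw [hab]; group
      change a⁻¹ * (h * t * h⁻¹) ∈ K
      rw [this]
      exact K.mul_mem (K.mul_mem (K.inv_mem hh') htK) (K.inv_mem hh)
    · intro t _; group
    · intro t _; group

end CaseNoThreeCycle

theorem pow_three_lt_factorial {q : ℕ} (hq : 7 ≤ q) : 6 * q ^ 3 + 2 < q.factorial := by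
  induction q, hq using Nat.le_induction with
  | base => decide
  | succ q hq ih =>
    rw [Nat.factorial_succ]
    nlinarith [Nat.mul_le_mul hq hq, Nat.mul_le_mul (Nat.mul_le_mul hq hq) hq]

theorem four_mul_sq_le_factorial {q : ℕ} (hq : 5 ≤ q) :
    (2 * q - 1) * (2 * q - 2) ≤ q.factorial := by
  have : 4 * q ^ 2 + 2 ≤ q.factorial + 6 * q := by
    induction q, hq using Nat.le_induction with
    | base => decide
    | succ q hq ih =>
      rw [Nat.factorial_succ]
      nlinarith [Nat.mul_le_mul hq hq, Nat.mul_le_mul (Nat.mul_le_mul hq hq) hq]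
  obtain ⟨p, rfl⟩ : ∃ p, q = p + 1 := ⟨q - 1, by omega⟩
  have h1 : 2 * (p + 1) - 1 = 2 * p + 1 := by omega
  have h2 : 2 * (p + 1) - 2 = 2 * p := by omega
  rw [h1, h2]
  nlinarith

theorem eq_ten_and_eq_of_dvd {m n : ℕ} (h9 : 9 ≤ m) (h12 : m ≤ 12)
    (hle : (m - m / 2).factorial ≤ 2 * n) (h1 : n - 1 ∣ 2 * m.choose 3)
    (h2 : 2 * n ∣ m.factorial) : m = 10 ∧ n = 81 := by
  obtain ⟨q, hq⟩ := h1
  have aux : ∀ {c r : ℕ}, (n - 1) * q = c → c < (n - 1) * (r + 1) → 0 < c → q ≤ r ∧ 0 < q := by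
    intro c r h h' hc
    constructor
    · by_contra hcon
      have := Nat.mul_le_mul_left (n - 1) (show r + 1 ≤ q by omega)
      omega
    · rcases Nat.eq_zero_or_pos q with rfl | h0
      · omega
      · exact h0
  interval_cases m
  · rw [show Nat.choose 9 3 = 84 by decide] at hq
    rw [show Nat.factorial (9 - 9 / 2) = 120 by decide] at hle
    rw [show Nat.factorial 9 = 362880 by decide] at h2
    obtain ⟨h, h'⟩ := aux (r := 2) hq.symm (by omega) (by omega)
    exfalso
    interval_cases q
    · have : n = 169 := by omega
      subst this; omega
    · have : n = 85 := by omega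
      subst this; omega
  · rw [show Nat.choose 10 3 = 120 by decide] at hq
    rw [show Nat.factorial (10 - 10 / 2) = 120 by decide] at hle
    rw [show Nat.factorial 10 = 3628800 by decide] at h2
    obtain ⟨h, h'⟩ := aux (r := 4) hq.symm (by omega) (by omega)
    interval_cases q
    · have : n = 241 := by omega
      subst this; omega
    · have : n = 121 := by omega
      subst this; omega
    · omega
    · have : n = 61 := by omega
      subst this; omega
  · rw [show Nat.choose 11 3 = 165 by decide] at hq
    rw [show Nat.factorial (11 - 11 / 2) = 720 by decide] at hle
    obtain ⟨h, h'⟩ := aux (r := 0) hq.symm (by omega) (by omega)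
    omega
  · rw [show Nat.choose 12 3 = 220 by decide] at hq
    rw [show Nat.factorial (12 - 12 / 2) = 720 by decide] at hle
    rw [show Nat.factorial 12 = 479001600 by decide] at h2
    obtain ⟨h, h'⟩ := aux (r := 1) hq.symm (by omega) (by omega)
    interval_cases q
    have : n = 441 := by omega
    subst this; omega

section CaseNoThreeCycle

open Equiv Equiv.Perm

variable {α : Type*} [Fintype α] [DecidableEq α] {K : Subgroup (Perm α)} {n : ℕ}

theorem exists_eq_threeCycle {g : Perm α} (hg : g.IsThreeCycle) :
    ∃ x y z, x ≠ y ∧ y ≠ z ∧ x ≠ z ∧ g = threeCycle x y z := by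
  obtain ⟨a, ha⟩ : ∃ a, a ∈ g.support :=
    Finset.card_pos.mp (by rw [hg.card_support]; norm_num)
  obtain ⟨h1, h2⟩ := List.nodup_cons.mp (hg.nodup_iff_mem_support.mpr ha)
  refine ⟨a, g a, g (g a), ?_, ?_, ?_, hg.eq_swap_mul_swap_iff_mem_support.mpr ha⟩
  all_goals simp_all

theorem sub_one_dvd_two_mul_choose (hα : 3 ≤ Fintype.card α) (hKA : K ≤ alternatingGroup α)
    (h3 : ∀ x y z, x ≠ y → y ≠ z → x ≠ z → threeCycle x y z ∉ K)
    (hn : n * Nat.card K = Nat.card (alternatingGroup α))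
    (htrans : ∀ a ∈ alternatingGroup α, ∀ b ∈ alternatingGroup α, a ∉ K → b ∉ K →
      ∃ h ∈ K, ∃ h' ∈ K, a = h * b * h') : n - 1 ∣ 2 * (Fintype.card α).choose 3 := by
  have h := sub_one_dvd_card hKA hn htrans (Finset.univ.filter fun g => g.cycleType = {3})
    ?_ ?_ ?_
  · rwa [card_of_cycleType_singleton (by norm_num) hα] at h
  · intro t ht
    exact IsThreeCycle.mem_alternatingGroup (Finset.mem_filter.mp ht).2
  · intro t ht
    obtain ⟨x, y, z, hxy, hyz, hxz, rfl⟩ := exists_eq_threeCycle (Finset.mem_filter.mp ht).2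
    exact h3 x y z hxy hyz hxz
  · intro t ht g _
    simpa [cycleType_conj] using ht

theorem largeNotDoublyTransitive_of_threeCycle_notMem (hα : 9 ≤ Fintype.card α)
    (hKA : K ≤ alternatingGroup α)
    (h3 : ∀ x y z, x ≠ y → y ≠ z → x ≠ z → threeCycle x y z ∉ K)
    (hn : n * Nat.card K = Nat.card (alternatingGroup α)) :
    LargeNotDoublyTransitive K n := by
  obtain ⟨D, hD, hDcard⟩ := exists_isBase_two_mul_card_le h3
  set m := Fintype.card α with hm
  have hbound := card_mul_factorial_le hn (by omega) hD ⊥ (by simp)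
  rw [Subgroup.card_bot, one_mul, ← hm] at hbound
  have hmono : (m - m / 2).factorial ≤ 2 * n :=
    (Nat.factorial_le (by omega)).trans hbound
  refine ⟨?_, ?_, ?_⟩
  · rw [← hm, Nat.choose_two_right]
    have h1 := four_mul_sq_le_factorial (q := m - m / 2) (by omega)
    have h2 : (m - 1) * (m - 1 - 1) ≤ (2 * (m - m / 2) - 1) * (2 * (m - m / 2) - 2) :=
      Nat.mul_le_mul (by omega) (by omega)
    omega
  · intro h9
    rw [← hm] at h9
    rw [h9] at hmono
    have : (9 - 9 / 2).factorial = 120 := by decide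
    omega
  · by_contra hcon
    have htrans : ∀ a ∈ alternatingGroup α, ∀ b ∈ alternatingGroup α, a ∉ K → b ∉ K →
      ∃ h ∈ K, ∃ h' ∈ K, a = h * b * h' := by
      intro a ha b hb haK hbK
      by_contra h
      exact hcon ⟨a, ha, b, hb, haK, hbK, h⟩
    have hdvd := sub_one_dvd_two_mul_choose (by omega) hKA h3 hn htrans
    have : Nontrivial α := Fintype.one_lt_card_iff_nontrivial.mp (by omega)
    have hcardA : 2 * (n * Nat.card K) = m.factorial := by
      rw [hn, two_mul_nat_card_alternatingGroup, Nat.card_perm, Nat.card_eq_fintype_card]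
    have hdvdn : 2 * n ∣ m.factorial := ⟨Nat.card K, by rw [← hcardA]; ring⟩
    have hle := Nat.le_of_dvd (Nat.mul_pos two_pos (Nat.choose_pos (by omega))) hdvd
    rw [← hm] at hdvd hle
    by_cases h13 : 13 ≤ m
    · have h1 := pow_three_lt_factorial (q := m - m / 2) (by omega)
      have h2 : m.choose 3 ≤ (2 * (m - m / 2)).choose 3 := Nat.choose_le_choose 3 (by omega)
      have h3 : 6 * (2 * (m - m / 2)).choose 3 ≤ (2 * (m - m / 2)) ^ 3 := by
        rw [show 6 = Nat.factorial 3 by rfl, ← Nat.descFactorial_eq_factorial_mul_choose]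
        exact Nat.descFactorial_le_pow _ _
      rw [mul_pow] at h3
      omega
    · obtain ⟨hm10, hn81⟩ := eq_ten_and_eq_of_dvd hα (by omega) hmono hdvd hdvdn
      have hK : Nat.card K = 22400 := by
        rw [hm10, hn81, show Nat.factorial 10 = 3628800 by decide] at hcardA
        omega
      obtain ⟨E, hDE, hE⟩ := Finset.exists_superset_card_eq (s := D) (n := 5) (by omega)
        (by omega)
      have hEb : IsBase K E := fun g hg h => hD g hg fun x hx => h x (hDE hx)
      obtain ⟨x, y, z, -, -, -, hxy, hxz, hyz⟩ :=
        Finset.two_lt_card_iff.mp (show 2 < (Finset.univ : Finset {x // x ∈ E}).card by simp [hE])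
      have h3 := threeCycle.isThreeCycle hxy hyz hxz
      have := card_mul_factorial_le hn (by omega) hEb (Subgroup.zpowers (threeCycle x y z))
        (by rw [Nat.card_zpowers, h3.orderOf, hK]; decide)
      rw [Nat.card_zpowers, h3.orderOf, hE, ← hm, hm10, hn81] at this
      simp [Nat.factorial] at this

end CaseNoThreeCycle

/-- A commuting family of operators with `T ^ 3 = 1` in characteristic `2` has an operator onto
the joint eigenspace of a primitive cube root of unity. -/
theorem exists_jointEigenspace_projection {F V ι : Type*} [Field F] [CharP F 2] [AddCommGroup V]
    [Module F V] {ω : F} (hω : ω ^ 2 + ω + 1 = 0) (T : ι → Module.End F V) (s : Finset ι)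
    (hcomm : ∀ i j, Commute (T i) (T j)) (hcube : ∀ i, T i * (T i * T i) = 1) :
    ∃ p : Module.End F V, (∀ v, (∀ i ∈ s, T i v = ω • v) → p v = v) ∧
      (∀ i ∈ s, T i * p = ω • p) ∧ ∀ g, (∀ i, Commute g (T i)) → Commute g p := by
  classical
  have h2 : (2 : F) = 0 := CharP.cast_eq_zero F 2
  have hω3 : ω * ω ^ 2 = 1 := by linear_combination (ω - 1) * hω
  induction s using Finset.induction_on with
  | empty => exact ⟨1, by simp, by simp, fun g _ => Commute.one_right g⟩
  | insert i s _ ih =>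
    obtain ⟨p, hp1, hp2, hp3⟩ := ih
    set q : Module.End F V := 1 + ω ^ 2 • T i + ω • (T i * T i) with hq
    have hqc : ∀ g, (∀ j, Commute g (T j)) → Commute g q := fun g hg =>
      ((Commute.one_right g).add_right ((hg i).smul_right _)).add_right
        (((hg i).mul_right (hg i)).smul_right _)
    have hTq : T i * q = ω • q := by
      rw [hq, mul_add, mul_add, mul_smul_comm, mul_smul_comm, hcube, smul_add, smul_add, smul_smul,
        smul_smul, hω3, mul_one, one_smul, ← sq ω]
      abel
    refine ⟨q * p, fun v hv => ?_, fun j hj => ?_, fun g hg => (hqc g hg).mul_right (hp3 g hg)⟩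
    · have h1 : T i v = ω • v := hv i (Finset.mem_insert_self _ _)
      rw [Module.End.mul_apply, hp1 v fun j hj => hv j (Finset.mem_insert_of_mem hj)]
      simp only [hq, LinearMap.add_apply, Module.End.one_apply, LinearMap.smul_apply,
        Module.End.mul_apply, h1, map_smul, smul_smul]
      have : (1 : F) + ω ^ 2 * ω + ω * (ω * ω) = 1 := by
        linear_combination 2 * hω3 + h2
      calc v + (ω ^ 2 * ω) • v + (ω * (ω * ω)) • v = (1 + ω ^ 2 * ω + ω * (ω * ω)) • v := by
            rw [add_smul, add_smul, one_smul]
        _ = v := by rw [this, one_smul]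
    · rcases Finset.mem_insert.1 hj with rfl | hj
      · rw [← mul_assoc, hTq, smul_mul_assoc]
      · rw [← mul_assoc, (hqc (T j) fun k => hcomm j k).eq, mul_assoc, hp2 j hj, mul_smul_comm]

/-- Joint eigenvectors of a commuting family with distinct weights are linearly independent. -/
theorem card_le_finrank_of_jointEigenvector {F V ι κ : Type*} [Field F] [AddCommGroup V]
    [Module F V] [FiniteDimensional F V] [Fintype κ] (T : ι → Module.End F V)
    (hcomm : ∀ i j, Commute (T i) (T j)) (c : κ → ι → F) (hc : Function.Injective c)
    (h : ∀ k, ∃ v : V, v ≠ 0 ∧ ∀ i, T i v = c k i • v) :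
    Fintype.card κ ≤ Module.finrank F V := by
  choose v hv0 hv using h
  have hind := Module.End.independent_iInf_maxGenEigenspace_of_forall_mapsTo T
    fun i j φ => Module.End.mapsTo_maxGenEigenspace_of_comm (hcomm j i) φ
  refine LinearIndependent.fintype_card_le_finrank (R := F) (b := v)
    ((hind.comp hc).linearIndependent _ (fun k => ?_) hv0)
  simp only [Function.comp_apply, Submodule.mem_iInf]
  intro i
  exact (Module.End.mem_maxGenEigenspace _ _ _).2 ⟨1, by simp [hv]⟩

theorem two_pow_le_choose_two_mul (a : ℕ) : 2 ^ a ≤ (2 * a).choose a := by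
  rw [← Nat.centralBinom]
  induction a with
  | zero => simp
  | succ a ih =>
    have := Nat.succ_mul_centralBinom_succ a
    rw [pow_succ]
    nlinarith

theorem two_pow_le_choose_mul_two_pow {k w : ℕ} (hw : w ≤ k) (hk : k ≤ 2 * w) :
    2 ^ k ≤ k.choose w * 2 ^ w := by
  obtain ⟨a, rfl⟩ := Nat.exists_eq_add_of_le hw
  have h1 : 2 ^ a ≤ (w + a).choose w := by
    rw [Nat.choose_symm_add]
    exact (two_pow_le_choose_two_mul a).trans (Nat.choose_le_choose a (by omega))
  calc 2 ^ (w + a) = 2 ^ a * 2 ^ w := by rw [add_comm, pow_add]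
    _ ≤ _ := Nat.mul_le_mul_right _ h1

section AltRep

variable {F V α : Type*} [Field F] [AddCommGroup V] [Module F V] [Fintype α] [DecidableEq α]

open Equiv Equiv.Perm

open Classical in
/-- A representation of the alternating group, extended by zero to all permutations. -/
noncomputable def altRep (ρ : Representation F (alternatingGroup α) V) (g : Perm α) :
    Module.End F V :=
  if h : g ∈ alternatingGroup α then ρ ⟨g, h⟩ else 0

variable (ρ : Representation F (alternatingGroup α) V)

theorem altRep_of_mem {g : Perm α} (hg : g ∈ alternatingGroup α) : altRep ρ g = ρ ⟨g, hg⟩ :=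
  dif_pos hg

theorem altRep_one : altRep ρ 1 = 1 := by
  rw [altRep_of_mem ρ (one_mem _)]
  exact map_one ρ

theorem altRep_mul {g h : Perm α} (hg : g ∈ alternatingGroup α) (hh : h ∈ alternatingGroup α) :
    altRep ρ (g * h) = altRep ρ g * altRep ρ h := by
  rw [altRep_of_mem ρ (mul_mem hg hh), altRep_of_mem ρ hg, altRep_of_mem ρ hh, ← map_mul]
  rfl

theorem altRep_mul_apply {g h : Perm α} (hg : g ∈ alternatingGroup α)
    (hh : h ∈ alternatingGroup α) (v : V) : altRep ρ (g * h) v = altRep ρ g (altRep ρ h v) := by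
  rw [altRep_mul ρ hg hh, Module.End.mul_apply]

theorem altRep_inv_apply_self {g : Perm α} (hg : g ∈ alternatingGroup α) (v : V) :
    altRep ρ g⁻¹ (altRep ρ g v) = v := by
  rw [← altRep_mul_apply ρ (inv_mem hg) hg, inv_mul_cancel, altRep_one, Module.End.one_apply]

theorem altRep_apply_ne_zero {g : Perm α} (hg : g ∈ alternatingGroup α) {v : V} (hv : v ≠ 0) :
    altRep ρ g v ≠ 0 := fun h => hv (by rw [← altRep_inv_apply_self ρ hg v, h, map_zero])

theorem altRep_commute {g h : Perm α} (hg : g ∈ alternatingGroup α) (hh : h ∈ alternatingGroup α)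
    (hgh : Commute g h) : Commute (altRep ρ g) (altRep ρ h) := by
  rw [Commute, SemiconjBy, ← altRep_mul ρ hg hh, ← altRep_mul ρ hh hg, hgh.eq]

/-- The `3`-cycle attached to the `i`-th block of a family of disjoint ordered triples. -/
def tripleCycle {I : Type*} (E : I × Fin 3 ↪ α) (i : I) : Perm α :=
  threeCycle (E (i, 0)) (E (i, 1)) (E (i, 2))

omit [Fintype α] [DecidableEq α] in
theorem embedding_ne {I : Type*} (E : I × Fin 3 ↪ α) {i j : I} {k l : Fin 3} (h : k ≠ l) :
    E (i, k) ≠ E (j, l) := fun he => h (congrArg Prod.snd (E.injective he))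

theorem tripleCycle_mem {I : Type*} (E : I × Fin 3 ↪ α) (i : I) :
    tripleCycle E i ∈ alternatingGroup α :=
  threeCycle.mem_alternatingGroup (embedding_ne E (by decide)) (embedding_ne E (by decide))

omit [Fintype α] in
theorem tripleCycle_apply_of_ne {I : Type*} (E : I × Fin 3 ↪ α) {i : I} {x : α}
    (hx : ∀ k, E (i, k) ≠ x) : tripleCycle E i x = x :=
  threeCycle.apply_of_ne (hx 0).symm (hx 1).symm (hx 2).symm

omit [Fintype α] in
theorem tripleCycle_conj {I : Type*} (E : I × Fin 3 ↪ α) (i : I) (g : Perm α) :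
    g * tripleCycle E i * g⁻¹ = tripleCycle (E.trans g.toEmbedding) i :=
  threeCycle.conj g _ _ _

omit [Fintype α] in
theorem threeCycle_commute_tripleCycle {I : Type*} (E : I × Fin 3 ↪ α) (i : I) {x y z : α}
    (hx : ∀ k, E (i, k) ≠ x) (hy : ∀ k, E (i, k) ≠ y) (hz : ∀ k, E (i, k) ≠ z) :
    Commute (tripleCycle E i) (threeCycle x y z) := by
  have := threeCycle.conj (tripleCycle E i) x y z
  rw [tripleCycle_apply_of_ne E hx, tripleCycle_apply_of_ne E hy,
    tripleCycle_apply_of_ne E hz] at this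
  exact mul_inv_eq_iff_eq_mul.1 this

omit [Fintype α] in
theorem tripleCycle_commute {I : Type*} (E : I × Fin 3 ↪ α) (i j : I) :
    Commute (tripleCycle E i) (tripleCycle E j) := by
  by_cases hij : i = j
  · rw [hij]
  · have h : ∀ k l, E (i, k) ≠ E (j, l) := fun k l he => hij (congrArg Prod.fst (E.injective he))
    exact threeCycle_commute_tripleCycle E i (fun k => h k 0) (fun k => h k 1) (fun k => h k 2)

omit [Fintype α] in
theorem threeCycle_mul_self_mul {a b c : α} (hab : a ≠ b) (hbc : b ≠ c) (hac : a ≠ c) :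
    threeCycle a b c * (threeCycle a b c * threeCycle a b c) = 1 := by
  ext x
  by_cases hxa : x = a
  · subst hxa
    simp [threeCycle.apply_left hab hac, threeCycle.apply_mid hbc hac, threeCycle.apply_right]
  by_cases hxb : x = b
  · subst hxb
    simp [threeCycle.apply_left hab hac, threeCycle.apply_mid hbc hac, threeCycle.apply_right]
  by_cases hxc : x = c
  · subst hxc
    simp [threeCycle.apply_left hab hac, threeCycle.apply_mid hbc hac, threeCycle.apply_right]
  simp [threeCycle.apply_of_ne hxa hxb hxc]

theorem altRep_threeCycle_cube {a b c : α} (hab : a ≠ b) (hbc : b ≠ c) (hac : a ≠ c) :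
    altRep ρ (threeCycle a b c) * (altRep ρ (threeCycle a b c) * altRep ρ (threeCycle a b c)) =
      1 := by
  have hm := threeCycle.mem_alternatingGroup hab hbc
  rw [← altRep_mul ρ hm hm, ← altRep_mul ρ hm (mul_mem hm hm), threeCycle_mul_self_mul hab hbc hac,
    altRep_one]

/-- Some nonzero vector is an eigenvector with eigenvalue `ω` for all `3`-cycles of `E`. -/
def HasWeight (ω : F) {I : Type*} (E : I × Fin 3 ↪ α) : Prop :=
  ∃ v : V, v ≠ 0 ∧ ∀ i, altRep ρ (tripleCycle E i) v = ω • v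

variable {ρ}

theorem HasWeight.conj {ω : F} {I : Type*} {E : I × Fin 3 ↪ α} (h : HasWeight ρ ω E) {g : Perm α}
    (hg : g ∈ alternatingGroup α) : HasWeight ρ ω (E.trans g.toEmbedding) := by
  obtain ⟨v, hv, h⟩ := h
  refine ⟨altRep ρ g v, altRep_apply_ne_zero ρ hg hv, fun i => ?_⟩
  rw [← tripleCycle_conj, altRep_mul_apply ρ (mul_mem hg (tripleCycle_mem E i)) (inv_mem hg),
    altRep_inv_apply_self ρ hg, altRep_mul_apply ρ hg (tripleCycle_mem E i), h, map_smul]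

theorem HasWeight.of_card {ω : F} {I J : Type*} [Fintype I] [Fintype J] {E : I × Fin 3 ↪ α}
    (h : HasWeight ρ ω E) (E' : J × Fin 3 ↪ α) (hIJ : Fintype.card J ≤ Fintype.card I)
    (hI : 3 * Fintype.card I + 2 ≤ Fintype.card α) : HasWeight ρ ω E' := by
  obtain ⟨φ⟩ := Function.Embedding.nonempty_of_card_le hIJ
  set E₀ : J × Fin 3 ↪ α := (φ.prodMap (Function.Embedding.refl _)).trans E with hE₀
  have h0 : HasWeight ρ ω E₀ := by
    obtain ⟨v, hv, h⟩ := h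
    exact ⟨v, hv, fun i => h (φ i)⟩
  obtain ⟨g, hg⟩ : ∃ g : Perm α, E₀.trans g.toEmbedding = E' := by
    obtain ⟨g, hg⟩ := Equiv.Perm.exists_smul_eq_embedding E₀ E'
    exact ⟨g, by ext x; exact DFunLike.congr_fun hg x⟩
  by_cases hA : g ∈ alternatingGroup α
  · exact hg ▸ h0.conj hA
  have hc : (Finset.univ.map E').card + 2 ≤ Fintype.card α := by
    rw [Finset.card_map, Finset.card_univ, Fintype.card_prod, Fintype.card_fin]
    omega
  have hc' : 1 < (Finset.univ.map E')ᶜ.card := by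
    rw [Finset.card_compl]; omega
  obtain ⟨x, hx, y, hy, hxy⟩ := Finset.one_lt_card.1 hc'
  have hsg : Equiv.swap x y * g ∈ alternatingGroup α := by
    rw [Equiv.Perm.mem_alternatingGroup, Equiv.Perm.sign_mul, Equiv.Perm.sign_swap hxy]
    rw [Equiv.Perm.mem_alternatingGroup] at hA
    rw [(Int.units_eq_one_or _).resolve_left hA]; rfl
  have : E₀.trans (Equiv.swap x y * g).toEmbedding = E' := by
    ext i
    have h1 : g (E₀ i) = E' i := DFunLike.congr_fun hg i
    simp only [Function.Embedding.trans_apply, Equiv.coe_toEmbedding, Equiv.Perm.mul_apply, h1]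
    apply Equiv.swap_apply_of_ne_of_ne
    · rintro rfl; simp at hx
    · rintro rfl; simp at hy
  exact this ▸ h0.conj hsg

end AltRep

section Dichotomy

variable {F V α : Type*} [Field F] [AddCommGroup V] [Module F V] [Fintype α] [DecidableEq α]

open Equiv Equiv.Perm

omit [Fintype α] [DecidableEq α] in
/-- Adjoin one ordered triple to a family of disjoint ordered triples. -/
def optionTriple {I : Type*} (E : I × Fin 3 ↪ α) {x y z : α} (hxy : x ≠ y) (hyz : y ≠ z)
    (hxz : x ≠ z) (hx : ∀ p, E p ≠ x) (hy : ∀ p, E p ≠ y) (hz : ∀ p, E p ≠ z) :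
    Option I × Fin 3 ↪ α where
  toFun p := p.1.elim (![x, y, z] p.2) fun i => E (i, p.2)
  inj' := by
    have hE : ∀ p k, E p ≠ ![x, y, z] k := fun p k => by fin_cases k <;> simp [hx, hy, hz]
    rintro ⟨_ | i, k⟩ ⟨_ | j, l⟩ h
    · refine Prod.ext rfl ?_
      fin_cases k <;> fin_cases l <;> simp_all
    · exact absurd h.symm (hE _ _)
    · exact absurd h (hE _ _)
    · have := E.injective h
      simp_all

variable {ρ : Representation F (alternatingGroup α) V}

theorem altRep_eq_sq_smul_of_inv {ω : F} (hω : ω ^ 2 * ω = 1) {g : Perm α}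
    (hg : g ∈ alternatingGroup α) {v : V} (hv : altRep ρ g v = ω • v) :
    altRep ρ g⁻¹ v = ω ^ 2 • v := by
  have h := altRep_inv_apply_self ρ hg v
  rw [hv, map_smul] at h
  rw [← one_smul F (altRep ρ g⁻¹ v), ← hω, mul_smul, h]

theorem exists_hasWeight_option [CharP F 2] {ω : F} (hω : ω ^ 2 + ω + 1 = 0) {I : Type*}
    {E : I × Fin 3 ↪ α} {v : V} (hv : ∀ i, altRep ρ (tripleCycle E i) v = ω • v) {x y z : α}
    (hxy : x ≠ y) (hyz : y ≠ z) (hxz : x ≠ z) (hx : ∀ p, E p ≠ x) (hy : ∀ p, E p ≠ y)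
    (hz : ∀ p, E p ≠ z) (hne : altRep ρ (threeCycle x y z) v ≠ v) :
    ∃ E' : Option I × Fin 3 ↪ α, HasWeight ρ ω E' := by
  have h2 : ∀ u : V, u + u = 0 := fun u => by
    rw [← two_smul F u, show (2 : F) = 0 from CharP.cast_eq_zero F 2, zero_smul]
  have hω3 : ω ^ 2 * ω = 1 := by linear_combination (ω - 1) * hω
  set t := threeCycle x y z with ht
  have htm : t ∈ alternatingGroup α := threeCycle.mem_alternatingGroup hxy hyz
  set T := altRep ρ t with hT
  have hT3 : ∀ u, T (T (T u)) = u := fun u =>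
    DFunLike.congr_fun (altRep_threeCycle_cube ρ hxy hyz hxz) u
  have hcomm : ∀ i u, altRep ρ (tripleCycle E i) (T u) = T (altRep ρ (tripleCycle E i) u) :=
    fun i u => DFunLike.congr_fun (altRep_commute ρ (tripleCycle_mem E i) htm
      (threeCycle_commute_tripleCycle E i (fun k => hx _) (fun k => hy _) (fun k => hz _))).eq u
  set v' := T v + T (T v) with hv'
  have hv'0 : v' ≠ 0 := by
    intro h0
    have h1 : T v = T (T v) := by
      rw [← sub_eq_zero, sub_eq_add_neg, neg_eq_of_add_eq_zero_left (h2 _), ← hv', h0]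
    have h3 := congrArg (fun u => T (T u)) h1
    simp only [hT3] at h3
    exact hne h3.symm
  have hTv' : ∀ i, altRep ρ (tripleCycle E i) v' = ω • v' := fun i => by
    rw [hv', map_add, hcomm, hcomm, hv, hcomm, hv, smul_add, map_smul, map_smul]
  have hsum : T (T v') + T v' + v' = 0 := by
    have : T (T v') + T v' + v' = (v + v) + (T v + T v) + (T (T v) + T (T v)) := by
      rw [hv', map_add, map_add, hT3]; abel
    rw [this, h2 v, h2 (T v), h2 (T (T v)), add_zero, add_zero]
  clear_value v'
  set u := T v' + ω • v' with hu
  by_cases hu0 : u = 0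
  · have hTu : T v' = ω • v' := by
      rw [← sub_eq_zero, sub_eq_add_neg, neg_eq_of_add_eq_zero_left (h2 _), ← hu, hu0]
    refine ⟨optionTriple E hxy hyz hxz hx hy hz, v', hv'0, ?_⟩
    rintro (_ | i)
    · exact hTu
    · exact hTv' i
  · refine ⟨optionTriple E hyz.symm hxy.symm hxz.symm hz hy hx, u, hu0, ?_⟩
    have hTu : T u = ω ^ 2 • u := by
      have h3 : ω + ω ^ 2 = 1 := by
        linear_combination hω - (CharP.cast_eq_zero F 2 : ((2 : ℕ) : F) = 0)
      have : T u + ω ^ 2 • u = 0 := by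
        have h4 : ω • T v' + ω ^ 2 • T v' = T v' := by rw [← add_smul, h3, one_smul]
        rw [hu, map_add, map_smul, smul_add, smul_smul, hω3, one_smul, ← hsum, add_assoc,
          ← add_assoc (ω • T v'), h4, add_assoc]
      rw [← sub_eq_zero, sub_eq_add_neg, neg_eq_of_add_eq_zero_left (h2 _), this]
    rintro (_ | i)
    · change altRep ρ (threeCycle z y x) u = _
      rw [← threeCycle.inv_eq, ← ht]
      have := altRep_eq_sq_smul_of_inv (ρ := ρ) (ω := ω ^ 2) (by
        linear_combination (ω ^ 2 * ω + 1) * hω3) htm hTu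
      rw [this]
      congr 1
      linear_combination ω * hω3
    · change altRep ρ (tripleCycle E i) u = _
      rw [hu, map_add, map_smul, hcomm, hTv', smul_add, map_smul]

/-- If the largest number of disjoint `3`-cycles having a common `ω`-eigenvector is attained by
`E`, then the `3`-cycles disjoint from `E` fix every such eigenvector. -/
theorem altRep_threeCycle_apply_eq_self [CharP F 2] {ω : F} (hω : ω ^ 2 + ω + 1 = 0) {w : ℕ}
    (hw : 3 * (w + 1) + 2 ≤ Fintype.card α)
    (hmax : ¬ ∃ E : Fin (w + 1) × Fin 3 ↪ α, HasWeight ρ ω E) {I : Type*} [Fintype I]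
    (hI : Fintype.card I = w) {E : I × Fin 3 ↪ α} {v : V}
    (hv : ∀ i, altRep ρ (tripleCycle E i) v = ω • v) {x y z : α}
    (hxy : x ≠ y) (hyz : y ≠ z) (hxz : x ≠ z) (hx : ∀ p, E p ≠ x) (hy : ∀ p, E p ≠ y)
    (hz : ∀ p, E p ≠ z) : altRep ρ (threeCycle x y z) v = v := by
  by_contra hne
  obtain ⟨E', h'⟩ := exists_hasWeight_option hω hv hxy hyz hxz hx hy hz hne
  have hc : Fintype.card (Option I) = w + 1 := by rw [Fintype.card_option, hI]
  exact hmax ⟨(((Fintype.equivFinOfCardEq hc).symm.toEmbedding).prodMap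
    (Function.Embedding.refl _)).trans E', h'.of_card _ (by rw [hc, Fintype.card_fin])
      (by rw [hc]; exact hw)⟩

/-- A family of joint weights of disjoint `3`-cycles. -/
def blockWeight {k : ℕ} (ω : F) (p : (_ : Finset (Fin k)) × Finset (Fin k)) (i : Fin k) : F :=
  if i ∈ p.1 then if i ∈ p.2 then ω else ω ^ 2 else 1

theorem blockWeight_injOn {k : ℕ} {ω : F} (h1 : ω ≠ 1) (h2 : ω ^ 2 ≠ 1) (h3 : ω ^ 2 ≠ ω)
    {p q : (_ : Finset (Fin k)) × Finset (Fin k)} (hp : p.2 ⊆ p.1) (hq : q.2 ⊆ q.1)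
    (h : blockWeight ω p = blockWeight ω q) : p = q := by
  have hA : ∀ p : (_ : Finset (Fin k)) × Finset (Fin k), ∀ i, i ∈ p.1 ↔ blockWeight ω p i ≠ 1 := by
    intro p i
    unfold blockWeight
    split_ifs <;> simp_all
  have hB : ∀ p : (_ : Finset (Fin k)) × Finset (Fin k), p.2 ⊆ p.1 →
      ∀ i, i ∈ p.2 ↔ blockWeight ω p i = ω := by
    intro p hp i
    have := @hp i
    unfold blockWeight
    split_ifs <;> simp_all [eq_comm]
  obtain ⟨W, S⟩ := p
  obtain ⟨W', S'⟩ := q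
  have e1 : W = W' := by
    ext i
    rw [hA ⟨W, S⟩, hA ⟨W', S'⟩, h]
  have e2 : S = S' := by
    ext i
    rw [hB ⟨W, S⟩ hp, hB ⟨W', S'⟩ hq, h]
  rw [e1, e2]

/-- Restrict a family of ordered triples to `W`, reversing the triples outside `S`. -/
def flipTriples {k : ℕ} (E : Fin k × Fin 3 ↪ α) (W S : Finset (Fin k)) : W × Fin 3 ↪ α where
  toFun p := E (p.1, if (p.1 : Fin k) ∈ S then p.2 else Equiv.swap 1 2 p.2)
  inj' := by
    rintro ⟨⟨i, hi⟩, a⟩ ⟨⟨j, hj⟩, b⟩ h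
    have h := E.injective h
    simp only [Prod.mk.injEq] at h
    obtain ⟨rfl, h⟩ := h
    split_ifs at h <;> simp_all

omit [Fintype α] in
theorem tripleCycle_flipTriples_of_mem {k : ℕ} (E : Fin k × Fin 3 ↪ α) {W S : Finset (Fin k)}
    {i : W} (hi : (i : Fin k) ∈ S) : tripleCycle (flipTriples E W S) i = tripleCycle E i := by
  have h : ∀ a, flipTriples E W S (i, a) = E (i, a) := fun a =>
    congrArg (fun b => E (i, b)) (if_pos hi)
  simp only [tripleCycle, h]

omit [Fintype α] in
theorem tripleCycle_flipTriples_of_notMem {k : ℕ} (E : Fin k × Fin 3 ↪ α) {W S : Finset (Fin k)}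
    {i : W} (hi : (i : Fin k) ∉ S) : (tripleCycle (flipTriples E W S) i)⁻¹ = tripleCycle E i := by
  have h : ∀ a, flipTriples E W S (i, a) = E (i, Equiv.swap 1 2 a) := fun a =>
    congrArg (fun b => E (i, b)) (if_neg hi)
  rw [tripleCycle, h, h, h, threeCycle.inv_eq]
  exact (threeCycle.rotate (embedding_ne E (k := 0) (l := 1) (by decide))
    (embedding_ne E (k := 1) (l := 2) (by decide))
    (embedding_ne E (k := 0) (l := 2) (by decide))).symm

theorem two_pow_le_finrank_of_hasWeight [CharP F 2] [FiniteDimensional F V] {ω : F}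
    (hω : ω ^ 2 + ω + 1 = 0) {k w : ℕ} (hk : 3 * k + 2 ≤ Fintype.card α) (hwk : w ≤ k)
    (hkw : k ≤ 2 * w) {E : Fin w × Fin 3 ↪ α} (hE : HasWeight ρ ω E)
    (hmax : w < k → ¬ ∃ E : Fin (w + 1) × Fin 3 ↪ α, HasWeight ρ ω E) :
    2 ^ k ≤ Module.finrank F V := by
  have h0 : (1 : F) ≠ 0 := one_ne_zero
  have h2 : (2 : F) = 0 := CharP.cast_eq_zero F 2
  have hω3 : ω ^ 2 * ω = 1 := by linear_combination (ω - 1) * hω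
  have hω1 : ω ≠ 1 := fun h => h0 (by rw [h] at hω; linear_combination hω - h2)
  have hω2 : ω ^ 2 ≠ 1 := fun h => hω1 (by rw [h, one_mul] at hω3; exact hω3)
  have hω21 : ω ^ 2 ≠ ω := fun h => h0 (by linear_combination hω - h - ω * h2)
  obtain ⟨E₀⟩ : Nonempty (Fin k × Fin 3 ↪ α) :=
    Function.Embedding.nonempty_of_card_le (by simp; omega)
  set P : Finset ((_ : Finset (Fin k)) × Finset (Fin k)) :=
    (Finset.powersetCard w Finset.univ).sigma fun W => W.powerset with hP
  have hPc : P.card = k.choose w * 2 ^ w := by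
    rw [hP, Finset.card_sigma, Finset.sum_congr rfl (g := fun _ => 2 ^ w), Finset.sum_const,
      Finset.card_powersetCard, Finset.card_univ, Fintype.card_fin, smul_eq_mul]
    intro W hW
    rw [Finset.card_powerset, (Finset.mem_powersetCard.1 hW).2]
  have hPm : ∀ p ∈ P, p.1.card = w ∧ p.2 ⊆ p.1 := fun p hp => by
    simpa [hP, Finset.mem_powersetCard] using hp
  refine (two_pow_le_choose_mul_two_pow hwk hkw).trans ?_
  rw [← hPc, ← Fintype.card_coe]
  refine card_le_finrank_of_jointEigenvector (fun i => altRep ρ (tripleCycle E₀ i))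
    (fun i j => altRep_commute ρ (tripleCycle_mem _ _) (tripleCycle_mem _ _)
      (tripleCycle_commute E₀ i j)) (fun p => blockWeight ω p.1)
    (fun p q h => Subtype.ext (blockWeight_injOn hω1 hω2 hω21 (hPm _ p.2).2 (hPm _ q.2).2 h)) ?_
  rintro ⟨⟨W, S⟩, hp⟩
  obtain ⟨hW, hS⟩ := hPm _ hp
  simp only at hW hS
  have hWc : Fintype.card W = w := by rw [Fintype.card_coe, hW]
  obtain ⟨v, hv0, hv⟩ := hE.of_card (flipTriples E₀ W S) (by rw [hWc, Fintype.card_fin])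
    (by rw [Fintype.card_fin]; omega)
  refine ⟨v, hv0, fun i => ?_⟩
  by_cases hi : i ∈ W
  · have hvi := hv ⟨i, hi⟩
    by_cases hiS : i ∈ S
    · rw [tripleCycle_flipTriples_of_mem E₀ hiS] at hvi
      simpa [blockWeight, hi, hiS] using hvi
    · have := altRep_eq_sq_smul_of_inv hω3 (tripleCycle_mem _ _) hvi
      rw [tripleCycle_flipTriples_of_notMem E₀ hiS] at this
      simpa [blockWeight, hi, hiS] using this
  · have hlt : w < k := by
      rw [← hW]
      simpa using Finset.card_lt_card (Finset.ssubset_univ_iff.2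
        (fun h : W = Finset.univ => hi (by rw [h]; exact Finset.mem_univ i)))
    have hd : ∀ a, ∀ p, flipTriples E₀ W S p ≠ E₀ (i, a) := fun a p h => by
      have h1 : (p.1 : Fin k) = i := congrArg Prod.fst (E₀.injective h)
      exact hi (h1 ▸ p.1.2)
    have := altRep_threeCycle_apply_eq_self hω (by omega) (hmax hlt) hWc hv
      (embedding_ne E₀ (i := i) (j := i) (k := 0) (l := 1) (by decide))
      (embedding_ne E₀ (i := i) (j := i) (k := 1) (l := 2) (by decide))
      (embedding_ne E₀ (i := i) (j := i) (k := 0) (l := 2) (by decide)) (hd 0) (hd 1) (hd 2)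
    simpa [blockWeight, hi, tripleCycle] using this

/-- Either the dimension of a representation of the alternating group is exponentially large, or
there are a nonzero vector and a linear functional not vanishing on it which are both fixed by all
`3`-cycles supported in a large subset. -/
theorem two_pow_le_finrank_or_exists_fixed [CharP F 2] [FiniteDimensional F V] [Nontrivial V]
    {ω : F} (hω : ω ^ 2 + ω + 1 = 0) (hα : 9 ≤ Fintype.card α) :
    2 ^ ((Fintype.card α - 2) / 3) ≤ Module.finrank F V ∨
      ∃ (J : Finset α) (v : V) (f : V →ₗ[F] F), Fintype.card α + 2 ≤ 2 * J.card ∧ f v ≠ 0 ∧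
        ∀ x ∈ J, ∀ y ∈ J, ∀ z ∈ J, x ≠ y → y ≠ z → x ≠ z →
          altRep ρ (threeCycle x y z) v = v ∧ ∀ u, f (altRep ρ (threeCycle x y z) u) = f u := by
  classical
  set k := (Fintype.card α - 2) / 3 with hk
  set P : ℕ → Prop := fun w => ∃ E : Fin w × Fin 3 ↪ α, HasWeight ρ ω E with hP
  have hP0 : P 0 := by
    obtain ⟨v, hv⟩ := exists_ne (0 : V)
    exact ⟨⟨fun p => p.1.elim0, fun p => p.1.elim0⟩, v, hv, fun i => i.elim0⟩
  set w := Nat.findGreatest P k with hw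
  have hwk : w ≤ k := Nat.findGreatest_le k
  obtain ⟨E, hE⟩ : P w := Nat.findGreatest_spec (Nat.zero_le k) hP0
  have hmax : w < k → ¬ P (w + 1) := fun h => Nat.findGreatest_is_greatest (Nat.lt_succ_self w) h
  by_cases hb : w < k ∧ 6 * w + 2 ≤ Fintype.card α
  · right
    obtain ⟨v, hv0, hv⟩ := hE
    have hmax := hmax hb.1
    have hfix := fun {u : V} (hu : ∀ i, altRep ρ (tripleCycle E i) u = ω • u) {x y z : α} =>
      altRep_threeCycle_apply_eq_self (x := x) (y := y) (z := z) hω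
        (by omega) hmax (Fintype.card_fin w) hu
    obtain ⟨p, hp1, hp2, hp3⟩ := exists_jointEigenspace_projection hω
      (fun i => altRep ρ (tripleCycle E i)) Finset.univ
      (fun i j => altRep_commute ρ (tripleCycle_mem _ _) (tripleCycle_mem _ _)
        (tripleCycle_commute E i j))
      (fun i => altRep_threeCycle_cube ρ (embedding_ne E (by decide))
        (embedding_ne E (by decide)) (embedding_ne E (by decide)))
    obtain ⟨f, hf⟩ : ∃ f : V →ₗ[F] F, f v ≠ 0 := by
      by_contra! h
      exact hv0 ((Module.forall_dual_apply_eq_zero_iff F v).1 h)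
    have hJ : (Finset.univ.map E).card = w * 3 := by simp
    refine ⟨(Finset.univ.map E)ᶜ, v, f ∘ₗ p, ?_, ?_, ?_⟩
    · rw [Finset.card_compl, hJ]; omega
    · rw [LinearMap.comp_apply, hp1 v fun i _ => hv i]
      exact hf
    · intro x hx y hy z hz hxy hyz hxz
      have hx' : ∀ q, E q ≠ x := by simpa using hx
      have hy' : ∀ q, E q ≠ y := by simpa using hy
      have hz' : ∀ q, E q ≠ z := by simpa using hz
      refine ⟨hfix hv hxy hyz hxz hx' hy' hz', fun u => ?_⟩
      have hc : Commute (altRep ρ (threeCycle x y z)) p := hp3 _ fun i =>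
        (altRep_commute ρ (tripleCycle_mem E i) (threeCycle.mem_alternatingGroup hxy hyz)
          (threeCycle_commute_tripleCycle E i (fun _ => hx' _) (fun _ => hy' _)
            (fun _ => hz' _))).symm
      have h1 : p (altRep ρ (threeCycle x y z) u) = altRep ρ (threeCycle x y z) (p u) :=
        (DFunLike.congr_fun hc.eq u).symm
      rw [LinearMap.comp_apply, LinearMap.comp_apply, h1,
        hfix (fun i => DFunLike.congr_fun (hp2 i (Finset.mem_univ i)) u) hxy hyz hxz hx' hy' hz']
  · left
    exact two_pow_le_finrank_of_hasWeight hω (by omega) hwk (by omega) hE hmax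

end Dichotomy

section FixedPair

variable {F V α : Type*} [Field F] [AddCommGroup V] [Module F V] [Fintype α] [DecidableEq α]

open Equiv Equiv.Perm

/-- An irreducible representation of the alternating group together with a vector and a linear
functional that are fixed by the `3`-cycles supported in a large set `J`. -/
structure IsFixedPair (ρ : Representation F (alternatingGroup α) V) (J : Finset α) (v : V)
    (f : V →ₗ[F] F) : Prop where
  card_le : Fintype.card α + 2 ≤ 2 * J.card
  apply_ne_zero : f v ≠ 0
  threeCycle : ∀ x ∈ J, ∀ y ∈ J, ∀ z ∈ J, x ≠ y → y ≠ z → x ≠ z →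
    altRep ρ (threeCycle x y z) v = v ∧ ∀ u, f (altRep ρ (threeCycle x y z) u) = f u
  eq_bot_or_top : ∀ p : Submodule F V,
    (∀ g ∈ alternatingGroup α, ∀ v ∈ p, altRep ρ g v ∈ p) → p = ⊥ ∨ p = ⊤

open Classical in
/-- Extend the orbit map of `v` to all permutations, using a transposition `σ`. -/
noncomputable def extVec (ρ : Representation F (alternatingGroup α) V) (σ : Perm α) (v : V)
    (h : Perm α) : V :=
  if h ∈ alternatingGroup α then altRep ρ h v else altRep ρ (h * σ) v

theorem mul_mem_alternatingGroup_of_notMem {g h : Perm α} (hg : g ∉ alternatingGroup α)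
    (hh : h ∉ alternatingGroup α) : g * h ∈ alternatingGroup α := by
  rw [mem_alternatingGroup] at *
  rw [Perm.sign_mul, (Int.units_eq_one_or _).resolve_left hg,
    (Int.units_eq_one_or _).resolve_left hh]
  rfl

theorem swap_notMem_alternatingGroup {x y : α} (h : x ≠ y) : swap x y ∉ alternatingGroup α := by
  rw [mem_alternatingGroup, sign_swap h]; decide

theorem mul_mem_alternatingGroup_iff {g h : Perm α} (hg : g ∈ alternatingGroup α) :
    g * h ∈ alternatingGroup α ↔ h ∈ alternatingGroup α :=
  Subgroup.mul_mem_cancel_left _ hg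

variable {ρ : Representation F (alternatingGroup α) V}

theorem extVec_of_mem {σ : Perm α} {v : V} {h : Perm α} (hh : h ∈ alternatingGroup α) :
    extVec ρ σ v h = altRep ρ h v := if_pos hh

theorem extVec_of_notMem {σ : Perm α} {v : V} {h : Perm α} (hh : h ∉ alternatingGroup α) :
    extVec ρ σ v h = altRep ρ (h * σ) v := if_neg hh

theorem extVec_mul {σ : Perm α} (hσ : σ ∉ alternatingGroup α) {v : V} {g : Perm α}
    (hg : g ∈ alternatingGroup α) (h : Perm α) :
    extVec ρ σ v (g * h) = altRep ρ g (extVec ρ σ v h) := by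
  by_cases hh : h ∈ alternatingGroup α
  · rw [extVec_of_mem (mul_mem hg hh), extVec_of_mem hh, altRep_mul_apply ρ hg hh]
  · rw [extVec_of_notMem (mt (mul_mem_alternatingGroup_iff hg).1 hh), extVec_of_notMem hh,
      mul_assoc, altRep_mul_apply ρ hg (mul_mem_alternatingGroup_of_notMem hh hσ)]

namespace IsFixedPair

variable {J : Finset α} {v : V} {f : V →ₗ[F] F}

theorem swap_mul_swap (H : IsFixedPair ρ J v f) {x y z w : α} (hx : x ∈ J) (hy : y ∈ J)
    (hz : z ∈ J) (hw : w ∈ J) (hxy : x ≠ y) (hzw : z ≠ w) :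
    altRep ρ (swap x y * swap z w) v = v ∧ ∀ u, f (altRep ρ (swap x y * swap z w) u) = f u := by
  have key : ∀ a ∈ J, ∀ b ∈ J, ∀ c ∈ J, a ≠ b → b ≠ c →
      altRep ρ (_root_.threeCycle a b c) v = v ∧
        ∀ u, f (altRep ρ (_root_.threeCycle a b c) u) = f u := by
    intro a ha b hb c hc hab hbc
    by_cases hac : a = c
    · have : _root_.threeCycle a b c = 1 := by
        rw [_root_.threeCycle, hac, swap_comm, swap_mul_self]
      rw [this, altRep_one]
      simp
    · exact H.threeCycle a ha b hb c hc hab hbc hac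
  by_cases hyz : y = z
  · subst hyz
    exact key x hx y hy w hw hxy hzw
  · have : swap x y * swap z w = _root_.threeCycle x y z * _root_.threeCycle y z w := by
      simp only [_root_.threeCycle]
      rw [mul_assoc, ← mul_assoc (swap y z), swap_mul_self, one_mul]
    have hm := threeCycle.mem_alternatingGroup hxy hyz
    have hm' := threeCycle.mem_alternatingGroup hyz hzw
    obtain ⟨h1, h2⟩ := key x hx y hy z hz hxy hyz
    obtain ⟨h3, h4⟩ := key y hy z hz w hw hyz hzw
    rw [this]
    exact ⟨by rw [altRep_mul_apply ρ hm hm', h3, h1],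
      fun u => by rw [altRep_mul_apply ρ hm hm', h2, h4]⟩

variable {x₀ y₀ : α}

theorem extVec_swap (H : IsFixedPair ρ J v f) (hx₀ : x₀ ∈ J) (hy₀ : y₀ ∈ J) (h₀ : x₀ ≠ y₀)
    {x y : α} (hx : x ∈ J) (hy : y ∈ J) (hxy : x ≠ y) :
    extVec ρ (swap x₀ y₀) v (swap x y) = v := by
  rw [extVec_of_notMem (swap_notMem_alternatingGroup hxy)]
  exact (H.swap_mul_swap hx hy hx₀ hy₀ hxy h₀).1

theorem apply_extVec_swap_mul (H : IsFixedPair ρ J v f) (hx₀ : x₀ ∈ J) (hy₀ : y₀ ∈ J)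
    (h₀ : x₀ ≠ y₀) (k : Perm α) :
    f (extVec ρ (swap x₀ y₀) v (swap x₀ y₀ * k)) = f (extVec ρ (swap x₀ y₀) v k) := by
  set σ := swap x₀ y₀ with hσ
  have hσm : σ ∉ alternatingGroup α := swap_notMem_alternatingGroup h₀
  have hσσ : σ * σ = 1 := swap_mul_self _ _
  have key : ∀ k ∈ alternatingGroup α, f (extVec ρ σ v (σ * k)) = f (extVec ρ σ v k) := by
    intro k hk
    have hcard : 1 < (J.filter fun x => k x ∈ J).card := by
      have h1 : (J.map k.toEmbedding).card = J.card := Finset.card_map _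
      have h2 := Finset.card_union_add_card_inter (J.map k.toEmbedding) J
      have h3 := Finset.card_le_univ (J.map k.toEmbedding ∪ J)
      have h4 : (J.map k.toEmbedding ∩ J).card ≤ (J.filter fun x => k x ∈ J).card := by
        rw [← Finset.card_map (s := J.filter _) k.toEmbedding]
        apply Finset.card_le_card
        intro x hx
        rw [Finset.mem_inter, Finset.mem_map] at hx
        simp only [Finset.mem_map, Finset.mem_filter]
        obtain ⟨⟨a, ha, rfl⟩, hx⟩ := hx
        exact ⟨a, ⟨ha, hx⟩, rfl⟩
      have := H.card_le
      omega
    obtain ⟨x, hx, y, hy, hxy⟩ := Finset.one_lt_card.1 hcard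
    rw [Finset.mem_filter] at hx hy
    have hkxy : k x ≠ k y := fun h => hxy (k.injective h)
    have hσk : σ * k ∉ alternatingGroup α := by
      rw [Subgroup.mul_mem_cancel_right _ hk]; exact hσm
    have e : σ * k * σ = σ * swap (k x) (k y) * (k * (swap x y * σ)) := by
      have : swap (k x) (k y) * k = k * swap x y := by
        rw [Equiv.swap_apply_apply, inv_mul_cancel_right]
      calc σ * k * σ = σ * (swap (k x) (k y) * swap (k x) (k y)) * k * σ := by
            rw [swap_mul_self, mul_one]
        _ = σ * swap (k x) (k y) * ((swap (k x) (k y) * k) * σ) := by simp only [mul_assoc]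
        _ = σ * swap (k x) (k y) * (k * (swap x y * σ)) := by rw [this, mul_assoc k]
    have hm2 := mul_mem_alternatingGroup_of_notMem (swap_notMem_alternatingGroup hxy) hσm
    rw [extVec_of_notMem hσk, e, altRep_mul_apply ρ
      (mul_mem_alternatingGroup_of_notMem hσm (swap_notMem_alternatingGroup hkxy))
      (mul_mem hk hm2),
      (H.swap_mul_swap hx₀ hy₀ hx.2 hy.2 h₀ hkxy).2, altRep_mul_apply ρ hk hm2,
      (H.swap_mul_swap hx.1 hy.1 hx₀ hy₀ hxy h₀).1, extVec_of_mem hk]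
  by_cases hk : k ∈ alternatingGroup α
  · exact key k hk
  · have := key (σ * k) (mul_mem_alternatingGroup_of_notMem hσm hk)
    rw [← mul_assoc, hσσ, one_mul] at this
    exact this.symm

theorem ne_zero (H : IsFixedPair ρ J v f) : v ≠ 0 := fun h => H.apply_ne_zero (by rw [h, map_zero])

theorem span_extVec (H : IsFixedPair ρ J v f) {σ : Perm α} (hσ : σ ∉ alternatingGroup α) :
    Submodule.span F (Set.range (extVec ρ σ v)) = ⊤ := by
  refine (H.eq_bot_or_top _ fun g hg u hu => ?_).resolve_left fun h => ?_
  · refine Submodule.span_induction ?_ ?_ ?_ ?_ hu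
    · rintro _ ⟨h, rfl⟩
      rw [← extVec_mul hσ hg]
      exact Submodule.subset_span ⟨_, rfl⟩
    · rw [map_zero]; exact zero_mem _
    · intro a b _ _ ha hb; rw [map_add]; exact add_mem ha hb
    · intro c a _ ha; rw [map_smul]; exact Submodule.smul_mem _ _ ha
  · have : v ∈ Submodule.span F (Set.range (extVec ρ σ v)) := by
      refine Submodule.subset_span ⟨1, ?_⟩
      rw [extVec_of_mem (one_mem _), altRep_one, Module.End.one_apply]
    rw [h, Submodule.mem_bot] at this
    exact H.ne_zero this

theorem eq_zero_of_forall_apply (H : IsFixedPair ρ J v f) {u : V}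
    (hu : ∀ g ∈ alternatingGroup α, f (altRep ρ g u) = 0) : u = 0 := by
  set p : Submodule F V := ⨅ g : alternatingGroup α, LinearMap.ker (f ∘ₗ altRep ρ g) with hp
  have hmem : ∀ u, u ∈ p ↔ ∀ g ∈ alternatingGroup α, f (altRep ρ g u) = 0 := by
    intro u
    simp [hp, Submodule.mem_iInf]
  rcases H.eq_bot_or_top p (fun g hg w hw => by
    rw [hmem] at hw ⊢
    intro k hk
    rw [← altRep_mul_apply ρ hk hg]
    exact hw _ (mul_mem hk hg)) with h | h
  · have := (hmem u).2 hu
    rwa [h, Submodule.mem_bot] at this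
  · have := (hmem v).1 (h ▸ Submodule.mem_top) 1 (one_mem _)
    rw [altRep_one, Module.End.one_apply] at this
    exact absurd this H.apply_ne_zero

/-- Linear relations among the vectors `extVec ρ σ v h` are preserved by left multiplication of
the indices by any permutation. -/
theorem sum_smul_extVec_mul_eq_zero (H : IsFixedPair ρ J v f) (hx₀ : x₀ ∈ J) (hy₀ : y₀ ∈ J)
    (h₀ : x₀ ≠ y₀) {c : Perm α → F} (hc : ∑ h, c h • extVec ρ (swap x₀ y₀) v h = 0) (τ : Perm α) :
    ∑ h, c h • extVec ρ (swap x₀ y₀) v (τ * h) = 0 := by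
  set σ := swap x₀ y₀ with hσ
  have hσm : σ ∉ alternatingGroup α := swap_notMem_alternatingGroup h₀
  have h1 : ∀ g ∈ alternatingGroup α, ∑ h, c h * f (extVec ρ σ v (g * h)) = 0 := by
    intro g hg
    have := congrArg (fun u => f (altRep ρ g u)) hc
    simpa [map_sum, ← extVec_mul hσm hg] using this
  have h2 : ∀ g, ∑ h, c h * f (extVec ρ σ v (g * h)) = 0 := by
    intro g
    by_cases hg : g ∈ alternatingGroup α
    · exact h1 g hg
    · rw [← h1 (σ * g) (mul_mem_alternatingGroup_of_notMem hσm hg)]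
      refine Finset.sum_congr rfl fun h _ => ?_
      rw [mul_assoc, H.apply_extVec_swap_mul hx₀ hy₀ h₀]
  refine H.eq_zero_of_forall_apply fun g hg => ?_
  rw [← h2 (g * τ)]
  simp [map_sum, ← extVec_mul hσm hg, mul_assoc]

/-- Every permutation acts linearly on the vectors `extVec ρ σ v h`. -/
theorem exists_linearMap (H : IsFixedPair ρ J v f) (hx₀ : x₀ ∈ J) (hy₀ : y₀ ∈ J)
    (h₀ : x₀ ≠ y₀) (τ : Perm α) :
    ∃ R : Module.End F V, ∀ h, R (extVec ρ (swap x₀ y₀) v h) =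
      extVec ρ (swap x₀ y₀) v (τ * h) := by
  set σ := swap x₀ y₀ with hσ
  have hσm : σ ∉ alternatingGroup α := swap_notMem_alternatingGroup h₀
  set Φ : (Perm α → F) →ₗ[F] V := Fintype.linearCombination F (extVec ρ σ v) with hΦ
  set Ψ : (Perm α → F) →ₗ[F] V := Fintype.linearCombination F fun h => extVec ρ σ v (τ * h)
    with hΨ
  have hsurj : LinearMap.range Φ = ⊤ := by
    rw [hΦ, Fintype.range_linearCombination, H.span_extVec hσm]
  have hker : ∀ c, Φ c = 0 → Ψ c = 0 := fun c hc =>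
    H.sum_smul_extVec_mul_eq_zero hx₀ hy₀ h₀ hc τ
  obtain ⟨S, hS⟩ := Φ.exists_rightInverse_of_surjective hsurj
  have hΦ1 : ∀ h, Φ (Pi.single h 1) = extVec ρ σ v h := fun h => by
    simp [hΦ, Fintype.linearCombination_apply_single]
  have hΨ1 : ∀ h, Ψ (Pi.single h 1) = extVec ρ σ v (τ * h) := fun h => by
    simp [hΨ, Fintype.linearCombination_apply_single]
  refine ⟨Ψ ∘ₗ S, fun h => ?_⟩
  rw [← hΨ1, ← hΦ1, LinearMap.comp_apply, ← sub_eq_zero, ← map_sub]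
  apply hker
  rw [map_sub, sub_eq_zero]
  exact DFunLike.congr_fun hS _

end IsFixedPair

end FixedPair

section Quadruple

variable {F V α : Type*} [Field F] [AddCommGroup V] [Module F V] [Fintype α] [DecidableEq α]

open Equiv Equiv.Perm

variable {ρ : Representation F (alternatingGroup α) V}

omit [Fintype α] in
theorem swap_conj_eq_self {x y p q : α} (h : (p = x ∨ p = y) ↔ (q = x ∨ q = y)) (hpq : p ≠ q) :
    swap x y * swap p q * (swap x y)⁻¹ = swap p q := by
  rw [← swap_apply_apply]
  by_cases hp : p = x ∨ p = y
  · have hq := h.1 hp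
    rcases hp with rfl | rfl
    · obtain rfl := hq.resolve_left hpq.symm
      rw [swap_apply_left, swap_apply_right, swap_comm]
    · obtain rfl := hq.resolve_right hpq.symm
      rw [swap_apply_left, swap_apply_right, swap_comm]
  · have hq := mt h.2 hp
    rw [not_or] at hp hq
    rw [swap_apply_of_ne_of_ne hp.1 hp.2, swap_apply_of_ne_of_ne hq.1 hq.2]

/-- The second difference of a weight function on transpositions. -/
theorem sum_secondDifference {a : Perm α → F} (ha : ∀ s, ¬ s.IsSwap → a s = 0) (e : Perm α → V)
    {x y z w : α} (hxy : x ≠ y) (hzw : z ≠ w) (hxz : x ≠ z) (hxw : x ≠ w) (hyz : y ≠ z)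
    (hyw : y ≠ w) :
    ∑ s, (a s - a (swap x y * s * (swap x y)⁻¹) - a (swap z w * s * (swap z w)⁻¹) +
        a (swap x y * swap z w * s * (swap x y * swap z w)⁻¹)) • e s =
      (a (swap x z) - a (swap y z) - a (swap x w) + a (swap y w)) •
        (e (swap x z) - e (swap y z) - e (swap x w) + e (swap y w)) := by
  set D : Perm α → F := fun s => a s - a (swap x y * s * (swap x y)⁻¹) -
    a (swap z w * s * (swap z w)⁻¹) + a (swap x y * swap z w * s * (swap x y * swap z w)⁻¹) with hD
  have hswap : ∀ (g : Perm α) (p q : α), g * swap p q * g⁻¹ = swap (g p) (g q) := fun g p q =>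
    (swap_apply_apply g p q).symm
  have x1 : swap x y x = y := swap_apply_left _ _
  have y1 : swap x y y = x := swap_apply_right _ _
  have z1 : swap z w z = w := swap_apply_left _ _
  have w1 : swap z w w = z := swap_apply_right _ _
  have z2 : swap x y z = z := swap_apply_of_ne_of_ne hxz.symm hyz.symm
  have w2 : swap x y w = w := swap_apply_of_ne_of_ne hxw.symm hyw.symm
  have x2 : swap z w x = x := swap_apply_of_ne_of_ne hxz hxw
  have y2 : swap z w y = y := swap_apply_of_ne_of_ne hyz hyw
  have hDs : ∀ p q, D (swap p q) = a (swap p q) - a (swap (swap x y p) (swap x y q)) -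
      a (swap (swap z w p) (swap z w q)) +
      a (swap (swap x y (swap z w p)) (swap x y (swap z w q))) := by
    intro p q
    simp only [hD, hswap, Perm.mul_apply]
  have hD0 : ∀ s, ¬ s.IsSwap → D s = 0 := by
    intro s hs
    have hc : ∀ g : Perm α, ¬ (g * s * g⁻¹).IsSwap := by
      rintro g ⟨p, q, hpq, h⟩
      refine hs ⟨g⁻¹ p, g⁻¹ q, g⁻¹.injective.ne hpq, ?_⟩
      rw [← hswap, ← h]
      group
    simp only [hD, ha s hs, ha _ (hc _)]
    ring
  have hxz' : swap x z ≠ swap y z := fun h => hxz.symm (by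
    simpa [swap_apply_of_ne_of_ne hxy hxz] using DFunLike.congr_fun h x)
  have hxw' : swap x w ≠ swap y w := fun h => hxw.symm (by
    simpa [swap_apply_of_ne_of_ne hxy hxw] using DFunLike.congr_fun h x)
  have h1 : swap x z ≠ swap x w := fun h => hzw (by simpa using DFunLike.congr_fun h x)
  have h2 : swap y z ≠ swap y w := fun h => hzw (by simpa using DFunLike.congr_fun h y)
  have h3 : swap x z ≠ swap y w := fun h => hxz.symm (by
    simpa [swap_apply_of_ne_of_ne hxy hxw] using DFunLike.congr_fun h x)
  have h4 : swap y z ≠ swap x w := fun h => hxw (by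
    simpa [swap_apply_of_ne_of_ne hxy hxz] using DFunLike.congr_fun h x)
  have hD1 : ∀ s, swap x y * s * (swap x y)⁻¹ = s → D s = 0 := by
    intro s hs
    have hc : swap x y * swap z w = swap z w * swap x y := by
      rw [← mul_inv_eq_iff_eq_mul, hswap, z2, w2]
    have : swap x y * swap z w * s * (swap x y * swap z w)⁻¹ = swap z w * s * (swap z w)⁻¹ := by
      calc _ = swap z w * (swap x y * s * (swap x y)⁻¹) * (swap z w)⁻¹ := by rw [hc]; group
        _ = _ := by rw [hs]
    simp only [hD, hs, this]
    ring
  have hD2 : ∀ s, swap z w * s * (swap z w)⁻¹ = s → D s = 0 := by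
    intro s hs
    have : swap x y * swap z w * s * (swap x y * swap z w)⁻¹ = swap x y * s * (swap x y)⁻¹ := by
      calc _ = swap x y * (swap z w * s * (swap z w)⁻¹) * (swap x y)⁻¹ := by group
        _ = _ := by rw [hs]
    simp only [hD, hs, this]
    ring
  have hsub : ∑ s, D s • e s =
      ∑ s ∈ ({swap x z, swap y z, swap x w, swap y w} : Finset (Perm α)), D s • e s := by
    refine (Finset.sum_subset (Finset.subset_univ _) fun s _ hs => ?_).symm
    simp only [Finset.mem_insert, Finset.mem_singleton, not_or] at hs
    obtain ⟨s1, s2, s3, s4⟩ := hs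
    suffices D s = 0 by rw [this, zero_smul]
    by_cases hsw : s.IsSwap
    · obtain ⟨p, q, hpq, rfl⟩ := hsw
      by_cases hp : (p = x ∨ p = y) ↔ (q = x ∨ q = y)
      · exact hD1 _ (swap_conj_eq_self hp hpq)
      by_cases hq : (p = z ∨ p = w) ↔ (q = z ∨ q = w)
      · exact hD2 _ (swap_conj_eq_self hq hpq)
      exfalso
      have main : ∀ p q, (p = x ∨ p = y) → (q = z ∨ q = w) → swap p q = swap x z ∨
          swap p q = swap y z ∨ swap p q = swap x w ∨ swap p q = swap y w := by
        intro p q hp hq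
        rcases hp with hp | hp <;> rcases hq with hq | hq <;> rw [hp, hq] <;> simp
      have hdis : ∀ p, (p = x ∨ p = y) → ¬ (p = z ∨ p = w) := by
        intro p hp
        rcases hp with hp | hp <;> rw [hp]
        · exact not_or.2 ⟨hxz, hxw⟩
        · exact not_or.2 ⟨hyz, hyw⟩
      have hfin : ¬ (swap p q = swap x z ∨ swap p q = swap y z ∨ swap p q = swap x w ∨
          swap p q = swap y w) := by simp only [s1, s2, s3, s4, or_self, not_false_eq_true]
      by_cases hp1 : p = x ∨ p = y
      · have h5 := hdis p hp1
        exact hfin (main p q hp1 (by by_contra h; exact hq (iff_of_false h5 h)))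
      · have hq1 : q = x ∨ q = y := by by_contra h; exact hp (iff_of_false hp1 h)
        have h5 := hdis q hq1
        rw [swap_comm p q] at hfin
        exact hfin (main q p hq1 (by by_contra h; exact hq (iff_of_false h h5)))
    · exact hD0 s hsw
  rw [hsub, Finset.sum_insert (by simp [hxz', h1, h3]), Finset.sum_insert (by simp [h4, h2]),
    Finset.sum_insert (by simp [hxw']), Finset.sum_singleton, hDs, hDs, hDs, hDs]
  simp only [x1, y1, z1, w1, x2, y2, z2, w2]
  module

end Quadruple

section FixedVector

variable {F V α : Type*} [Field F] [AddCommGroup V] [Module F V] [Fintype α] [DecidableEq α]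

open Equiv Equiv.Perm

variable {ρ : Representation F (alternatingGroup α) V}

/-- The stabilizer of a vector, as a group of even permutations. -/
def vectorStabilizer (ρ : Representation F (alternatingGroup α) V) (v : V) :
    Subgroup (Perm α) where
  carrier := {g | g ∈ alternatingGroup α ∧ altRep ρ g v = v}
  mul_mem' hg hh := ⟨mul_mem hg.1 hh.1, by rw [altRep_mul_apply ρ hg.1 hh.1, hh.2, hg.2]⟩
  one_mem' := ⟨one_mem _, by rw [altRep_one, Module.End.one_apply]⟩
  inv_mem' {g} hg := ⟨inv_mem hg.1, by
    conv_lhs => rw [← hg.2]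
    exact altRep_inv_apply_self ρ hg.1 v⟩

namespace IsFixedPair

variable {J : Finset α} {v : V} {f : V →ₗ[F] F} {x₀ y₀ : α}

/-- A class function on transpositions invariant under a group with scalar commutant gives a linear
relation between the images of `v` under transpositions. -/
theorem exists_sum_conj_smul_extVec (H : IsFixedPair ρ J v f) (hx₀ : x₀ ∈ J) (hy₀ : y₀ ∈ J)
    (h₀ : x₀ ≠ y₀) {X : Subgroup (Perm α)} (hX : X ≤ alternatingGroup α)
    (hschur : ∀ T : Module.End F V, (∀ x ∈ X, Commute (altRep ρ x) T) →
      ∃ c : F, ∀ u, T u = c • u)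
    {a : Perm α → F} (haX : ∀ x ∈ X, ∀ s, a (x * s * x⁻¹) = a s) :
    ∃ c : F, ∀ g, ∑ s, a (g * s * g⁻¹) • extVec ρ (swap x₀ y₀) v s = c • v := by
  set σ := swap x₀ y₀ with hσ
  have hσm : σ ∉ alternatingGroup α := swap_notMem_alternatingGroup h₀
  choose R hR using H.exists_linearMap hx₀ hy₀ h₀
  set T : Module.End F V := ∑ s, a s • R s with hT
  have hTe : ∀ h, T (extVec ρ σ v h) = ∑ s, a s • extVec ρ σ v (s * h) := fun h => by
    simp only [hT, LinearMap.sum_apply, LinearMap.smul_apply]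
    exact Finset.sum_congr rfl fun s _ => by rw [hR]
  obtain ⟨c, hc⟩ := hschur T (fun x hx => by
    refine LinearMap.ext_on_range (H.span_extVec hσm) fun h => ?_
    rw [Module.End.mul_apply, Module.End.mul_apply, ← extVec_mul hσm (hX hx), hTe, hTe, map_sum]
    refine Fintype.sum_equiv (MulAut.conj x).toEquiv _ _ fun s => ?_
    simp only [MulEquiv.toEquiv_eq_coe, MulEquiv.coe_toEquiv, MulAut.conj_apply, haX x hx,
      map_smul, ← extVec_mul hσm (hX hx)]
    congr 2
    group)
  refine ⟨c, fun g => ?_⟩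
  have h1 := hTe g
  rw [hc] at h1
  have h2 := congrArg (R g⁻¹) h1
  rw [map_smul, hR, inv_mul_cancel, extVec_of_mem (one_mem _), altRep_one, Module.End.one_apply,
    map_sum] at h2
  rw [h2]
  refine Fintype.sum_equiv (MulAut.conj g).toEquiv _ _ fun s => ?_
  simp only [MulEquiv.toEquiv_eq_coe, MulEquiv.coe_toEquiv, MulAut.conj_apply, map_smul]
  rw [hR]
  congr 2
  group

theorem extVec_alternating_sum_eq_zero (H : IsFixedPair ρ J v f) (hx₀ : x₀ ∈ J) (hy₀ : y₀ ∈ J)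
    (h₀ : x₀ ≠ y₀) {X : Subgroup (Perm α)} (hX : X ≤ alternatingGroup α)
    (hschur : ∀ T : Module.End F V, (∀ x ∈ X, Commute (altRep ρ x) T) →
      ∃ c : F, ∀ u, T u = c • u)
    {a : Perm α → F} (haX : ∀ x ∈ X, ∀ s, a (x * s * x⁻¹) = a s)
    (ha : ∀ s, ¬ s.IsSwap → a s = 0) {q : Fin 4 ↪ α}
    (hq : a (swap (q 0) (q 2)) - a (swap (q 1) (q 2)) - a (swap (q 0) (q 3)) +
      a (swap (q 1) (q 3)) ≠ 0) {x y z w : α}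
    (hxy : x ≠ y) (hzw : z ≠ w) (hxz : x ≠ z) (hxw : x ≠ w) (hyz : y ≠ z) (hyw : y ≠ w) :
    extVec ρ (swap x₀ y₀) v (swap x z) - extVec ρ (swap x₀ y₀) v (swap y z) -
      extVec ρ (swap x₀ y₀) v (swap x w) + extVec ρ (swap x₀ y₀) v (swap y w) = 0 := by
  obtain ⟨c, hc⟩ := H.exists_sum_conj_smul_extVec hx₀ hy₀ h₀ hX hschur haX
  obtain ⟨g, hg⟩ := Equiv.Perm.exists_extending_pair ![x, y, z, w] q (by
    intro i j hij
    fin_cases i <;> fin_cases j <;> simp_all [Ne.symm]) q.injective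
  have g0 : g x = q 0 := hg 0
  have g1 : g y = q 1 := hg 1
  have g2 : g z = q 2 := hg 2
  have g3 : g w = q 3 := hg 3
  set b : Perm α → F := fun s => a (g * s * g⁻¹) with hb
  have hbk : ∀ k, ∑ s, b (k * s * k⁻¹) • extVec ρ (swap x₀ y₀) v s = c • v := fun k => by
    rw [← hc (g * k)]
    refine Finset.sum_congr rfl fun s _ => ?_
    rw [show g * k * s * (g * k)⁻¹ = g * (k * s * k⁻¹) * g⁻¹ by group]
  have hb1 : ∑ s, b s • extVec ρ (swap x₀ y₀) v s = c • v := by simpa using hbk 1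
  have hsum := sum_secondDifference (a := b) (fun s hs => ha _ (by
    rintro ⟨p, q, hpq, h⟩
    refine hs ⟨g⁻¹ p, g⁻¹ q, g⁻¹.injective.ne hpq, ?_⟩
    have hs' : s = g⁻¹ * (g * s * g⁻¹) * g⁻¹⁻¹ := by group
    rw [swap_apply_apply, ← h]
    exact hs')) (extVec ρ (swap x₀ y₀) v) hxy hzw hxz hxw hyz hyw
  simp only [add_smul, sub_smul, Finset.sum_add_distrib, Finset.sum_sub_distrib, hbk, hb1] at hsum
  simp only [← add_smul, ← sub_smul] at hsum
  rw [sub_self, zero_sub, neg_add_cancel, zero_smul] at hsum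
  simp only [hb, ← swap_apply_apply, g0, g1, g2, g3] at hsum
  exact (smul_eq_zero.1 hsum.symm).resolve_left hq

/-- Under the hypotheses of `extVec_alternating_sum_eq_zero`, the vector `v` is fixed by the whole
alternating group. -/
theorem alternatingGroup_le_vectorStabilizer (H : IsFixedPair ρ J v f)
    (hα : 9 ≤ Fintype.card α) {X : Subgroup (Perm α)} (hX : X ≤ alternatingGroup α)
    (hschur : ∀ T : Module.End F V, (∀ x ∈ X, Commute (altRep ρ x) T) →
      ∃ c : F, ∀ u, T u = c • u)
    {a : Perm α → F} (haX : ∀ x ∈ X, ∀ s, a (x * s * x⁻¹) = a s)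
    (ha : ∀ s, ¬ s.IsSwap → a s = 0) {q : Fin 4 ↪ α}
    (hq : a (swap (q 0) (q 2)) - a (swap (q 1) (q 2)) - a (swap (q 0) (q 3)) +
      a (swap (q 1) (q 3)) ≠ 0) :
    alternatingGroup α ≤ vectorStabilizer ρ v := by
  have hJ : 5 < J.card := by have := H.card_le; omega
  have avoid : ∀ s : Finset α, s.card ≤ 5 → ∃ x ∈ J, x ∉ s := fun s hs => by
    by_contra! h
    have := Finset.card_le_card (show J ⊆ s from h)
    omega
  obtain ⟨x₀, hx₀, -⟩ := avoid ∅ (by simp)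
  obtain ⟨y₀, hy₀, h₀⟩ := avoid {x₀} (by simp)
  have h₀ : x₀ ≠ y₀ := fun h => h₀ (by simp [h])
  set σ := swap x₀ y₀ with hσ
  have hσm : σ ∉ alternatingGroup α := swap_notMem_alternatingGroup h₀
  have hσJ : ∀ p ∈ J, σ p ∈ J := fun p hp => by
    by_cases h1 : p = x₀
    · rwa [h1, hσ, swap_apply_left]
    by_cases h2 : p = y₀
    · rwa [h2, hσ, swap_apply_right]
    rwa [hσ, swap_apply_of_ne_of_ne h1 h2]
  have hfix : ∀ p ∉ J, σ p = p := fun p hp => by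
    rw [hσ, swap_apply_of_ne_of_ne] <;> rintro rfl <;> contradiction
  have hJJ : ∀ p ∈ J, ∀ r ∈ J, Linked (vectorStabilizer ρ v) p r := by
    intro p hp r hr
    by_cases hpr : p = r
    · exact hpr ▸ Linked.refl _
    obtain ⟨t, ht, htn⟩ := avoid {p, r} (Finset.card_le_two.trans (by omega))
    simp only [Finset.mem_insert, Finset.mem_singleton, not_or] at htn
    exact Linked.of_mem hpr (Ne.symm htn.2) (Ne.symm htn.1)
      ⟨threeCycle.mem_alternatingGroup hpr (Ne.symm htn.2),
        (H.threeCycle p hp r hr t ht hpr (Ne.symm htn.2) (Ne.symm htn.1)).1⟩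
  have hout : ∀ p ∉ J, ∀ r ∈ J, Linked (vectorStabilizer ρ v) r p := by
    intro p hp r hr
    obtain ⟨t, ht, htr⟩ := avoid {r} (by simp)
    have htr : t ≠ r := fun h => htr (by simp [h])
    obtain ⟨b, hb, hbn⟩ := avoid {σ r, σ t} (Finset.card_le_two.trans (by omega))
    simp only [Finset.mem_insert, Finset.mem_singleton, not_or] at hbn
    have hne : ∀ j ∈ J, p ≠ j := fun j hj h => hp (h ▸ hj)
    have h1 := H.extVec_alternating_sum_eq_zero hx₀ hy₀ h₀ hX hschur haX ha hq
      (hne b hb) (σ.injective.ne htr) (hne _ (hσJ t ht)) (hne _ (hσJ r hr)) hbn.2 hbn.1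
    rw [H.extVec_swap hx₀ hy₀ h₀ hb (hσJ t ht) hbn.2, H.extVec_swap hx₀ hy₀ h₀ hb (hσJ r hr) hbn.1,
      extVec_of_notMem (swap_notMem_alternatingGroup (hne _ (hσJ t ht))),
      extVec_of_notMem (swap_notMem_alternatingGroup (hne _ (hσJ r hr)))] at h1
    have h2 : altRep ρ (swap p (σ t) * σ) v = altRep ρ (swap p (σ r) * σ) v := by
      rw [← sub_eq_zero, ← h1]; abel
    have m1 := mul_mem_alternatingGroup_of_notMem
      (swap_notMem_alternatingGroup (hne _ (hσJ t ht))) hσm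
    have m2 := mul_mem_alternatingGroup_of_notMem
      (swap_notMem_alternatingGroup (hne _ (hσJ r hr))) hσm
    have hmem : (swap p (σ r) * σ)⁻¹ * (swap p (σ t) * σ) ∈ vectorStabilizer ρ v := by
      refine ⟨mul_mem (inv_mem m2) m1, ?_⟩
      rw [altRep_mul_apply ρ (inv_mem m2) m1, h2, altRep_inv_apply_self ρ m2]
    have he : (swap p (σ r) * σ)⁻¹ * (swap p (σ t) * σ) = _root_.threeCycle r p t := by
      have hσi : σ⁻¹ = σ := swap_inv _ _
      calc _ = σ⁻¹ * _root_.threeCycle (σ r) p (σ t) * σ⁻¹⁻¹ := by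
            rw [_root_.threeCycle, mul_inv_rev, inv_inv, swap_inv p, swap_comm p (σ r)]
            simp only [mul_assoc]
        _ = _root_.threeCycle r p t := by
            rw [threeCycle.conj, hσi, hfix p hp]
            simp [hσ]
    rw [he] at hmem
    exact Linked.of_mem (hne r hr).symm (hne t ht) htr.symm hmem
  refine Linked.alternatingGroup_le (by omega) fun p r => ?_
  by_cases hp : p ∈ J <;> by_cases hr : r ∈ J
  · exact hJJ p hp r hr
  · exact hout r hr p hp
  · exact (hout p hp r hr).symm
  · exact (hout p hp x₀ hx₀).symm.trans (hout r hr x₀ hx₀)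

theorem rank_le_one (H : IsFixedPair ρ J v f)
    (h : alternatingGroup α ≤ vectorStabilizer ρ v) : Module.rank F V ≤ 1 := by
  have : Submodule.span F {v} = ⊤ := by
    refine (H.eq_bot_or_top _ fun g hg u hu => ?_).resolve_left fun h => ?_
    · obtain ⟨c, rfl⟩ := Submodule.mem_span_singleton.1 hu
      rw [map_smul, (h hg).2]
      exact hu
    · exact H.ne_zero (Submodule.span_singleton_eq_bot.1 h)
  rw [← rank_top F V, ← this]
  exact rank_span_le _ |>.trans (by simp)

end IsFixedPair

end FixedVector

namespace RepIrreducible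

variable {F G V : Type*} [Field F] [Group G] [AddCommGroup V] [Module F V]
  {ρ : Representation F G V}

theorem finiteDimensional [Finite G] (h : RepIrreducible ρ) : FiniteDimensional F V := by
  obtain ⟨hV, h⟩ := h
  obtain ⟨v, hv⟩ := exists_ne (0 : V)
  have hfin : (Set.range fun g => ρ g v).Finite := Set.finite_range _
  have htop : Submodule.span F (Set.range fun g => ρ g v) = ⊤ := by
    refine (h _ fun g u hu => ?_).resolve_left fun hbot => hv ?_
    · refine (Submodule.span_le (p := (Submodule.span F _).comap (ρ g))).2 ?_ hu
      rintro _ ⟨k, rfl⟩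
      exact Submodule.subset_span ⟨g * k, by simp⟩
    · rw [Submodule.span_eq_bot] at hbot
      exact hbot v ⟨1, by simp⟩
  exact ⟨htop ▸ Submodule.fg_span hfin⟩

theorem eq_smul_of_commute [IsAlgClosed F] [Finite G] (h : RepIrreducible ρ) (T : Module.End F V)
    (hT : ∀ g, Commute (ρ g) T) : ∃ c : F, ∀ u, T u = c • u := by
  have := h.finiteDimensional
  obtain ⟨hV, h⟩ := h
  obtain ⟨c, hc⟩ := Module.End.exists_eigenvalue T
  have htop := (h (T.eigenspace c) fun g v hv => by
    rw [Module.End.mem_eigenspace_iff] at hv ⊢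
    rw [← Module.End.mul_apply, ← (hT g).eq, Module.End.mul_apply, hv, map_smul]).resolve_left hc
  exact ⟨c, fun u => Module.End.mem_eigenspace_iff.1 (htop ▸ Submodule.mem_top)⟩

/-- Burnside's theorem: the operators of an irreducible representation span all endomorphisms. -/
theorem span_range_eq_top [IsAlgClosed F] [Finite G] (h : RepIrreducible ρ) :
    Submodule.span F (Set.range ρ) = ⊤ := by
  have := h.finiteDimensional
  set A : Subalgebra F (Module.End F V) := Algebra.adjoin F (Set.range ρ) with hA
  have hmem : ∀ g, ρ g ∈ A := fun g => Algebra.subset_adjoin ⟨g, rfl⟩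
  have hV := h.1
  have hs : IsSimpleModule A V := by
    refine (isSimpleModule_iff ..).2 ⟨fun p => ?_⟩
    refine (h.2 (p.restrictScalars F) fun g v hv => p.smul_mem ⟨ρ g, hmem g⟩ hv).imp ?_ ?_ <;>
    · intro hp
      simpa using hp
  have hAspan : Subalgebra.toSubmodule A = Submodule.span F (Set.range ρ) := by
    rw [hA, Algebra.adjoin_eq_span, ← MonoidHom.coe_mrange, Submonoid.closure_eq]
  rw [← hAspan, eq_top_iff]
  intro f _
  let f' : Module.End (Module.End A V) V :=
    { toFun := f
      map_add' := map_add f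
      map_smul' := fun T v => by
        obtain ⟨c, hc⟩ := h.eq_smul_of_commute (T.restrictScalars F) fun g =>
          LinearMap.ext fun v => (T.map_smul (⟨ρ g, hmem g⟩ : A) v).symm
        have hc' : ∀ u, T u = c • u := hc
        simp only [Module.End.smul_def, RingHom.id_apply, hc', map_smul] }
  classical
  let b := Module.finBasis F V
  obtain ⟨r, hr⟩ := jacobson_density f' (Finset.univ.image b)
  have : f = r := b.ext fun i => hr (b i) (Finset.mem_image_of_mem _ (Finset.mem_univ i))
  rw [this]
  exact r.2

theorem finrank_sq_le_card [IsAlgClosed F] [Finite G] (h : RepIrreducible ρ) :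
    Module.finrank F V ^ 2 ≤ Nat.card G := by
  have := h.finiteDimensional
  have := Fintype.ofFinite G
  have hd : Module.finrank F (Module.End F V) = Module.finrank F V * Module.finrank F V :=
    Module.finrank_linearMap F F V V
  rw [sq, ← hd, ← finrank_top F (Module.End F V), ← h.span_range_eq_top,
    Nat.card_eq_fintype_card]
  exact finrank_range_le_card ρ

end RepIrreducible

theorem factorial_pow_three_lt_two_pow {m : ℕ} (hm : 10 ≤ m) :
    m.factorial ^ 3 < 2 ^ ((m - 1) * (m - 2) - 5) := by
  obtain ⟨k, rfl⟩ := Nat.exists_eq_add_of_le hm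
  induction k with
  | zero => norm_num [Nat.factorial]
  | succ k ih =>
    have hstep : (10 + k + 1) ^ 3 ≤ 2 ^ (2 * (k + 9)) := by
      clear ih hm
      induction k with
      | zero => norm_num
      | succ k ih =>
        calc (10 + (k + 1) + 1) ^ 3 ≤ 4 * (10 + k + 1) ^ 3 := by ring_nf; nlinarith
          _ ≤ 4 * 2 ^ (2 * (k + 9)) := by omega
          _ = 2 ^ (2 * (k + 1 + 9)) := by ring
    have he : (10 + (k + 1) - 1) * (10 + (k + 1) - 2) - 5 =
        2 * (k + 9) + ((10 + k - 1) * (10 + k - 2) - 5) := by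
      have e1 : (10 + (k + 1) - 1) * (10 + (k + 1) - 2) = (k + 10) * (k + 9) := by congr 1 <;> omega
      have e2 : (10 + k - 1) * (10 + k - 2) = (k + 9) * (k + 8) := by congr 1 <;> omega
      rw [e1, e2, show (k + 10) * (k + 9) = 2 * (k + 9) + (k + 9) * (k + 8) by ring,
        Nat.add_sub_assoc]
      nlinarith
    rw [show 10 + (k + 1) = 10 + k + 1 by ring, Nat.factorial_succ, mul_pow]
    rw [show 10 + (k + 1) = 10 + k + 1 by ring] at he
    rw [he, pow_add]
    exact Nat.mul_lt_mul_of_le_of_lt hstep (ih (by omega)) (by positivity)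

theorem factorial_lt_of_two_pow_le {m n d : ℕ} (hm : 9 ≤ m) (hn : (m - 1).choose 2 ≤ n)
    (hn9 : m = 9 → 29 ≤ n) (hd : 2 ^ ((n - 2) / 3) ≤ d) : m.factorial < 2 * d ^ 2 := by
  rcases hm.eq_or_lt with rfl | hm
  · have h9 : 2 ^ 9 ≤ d := (Nat.pow_le_pow_right (by norm_num) (by have := hn9 rfl; omega)).trans hd
    have := Nat.pow_le_pow_left h9 2
    rw [show Nat.factorial 9 = 362880 by rfl]
    omega
  · refine lt_of_pow_lt_pow_left₀ 3 (Nat.zero_le _)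
      ((factorial_pow_three_lt_two_pow hm).trans_le ?_)
    calc 2 ^ ((m - 1) * (m - 2) - 5) ≤ 2 ^ (3 + 6 * ((n - 2) / 3)) := by
          refine Nat.pow_le_pow_right (by norm_num) ?_
          have := Nat.choose_two_right (m - 1)
          obtain ⟨e, he⟩ := Nat.even_mul_pred_self (m - 1)
          rw [show m - 1 - 1 = m - 2 by omega] at this he
          omega
      _ = (2 * (2 ^ ((n - 2) / 3)) ^ 2) ^ 3 := by ring
      _ ≤ _ := by gcongr

section SecondDifference

variable {α : Type*} [Fintype α] [DecidableEq α]

open Equiv Equiv.Perm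

/-- No group of permutations preserves a nontrivial equivalence relation. -/
def PreservesOnlyTrivialSetoid (X : Subgroup (Perm α)) : Prop :=
  ∀ r : Setoid α, (∀ x ∈ X, ∀ a b, r a b → r (x a) (x b)) → (∃ a b, a ≠ b ∧ r a b) → ∀ a b, r a b

variable {X : Subgroup (Perm α)}

theorem forall_iff_of_forall_second_difference (hX : PreservesOnlyTrivialSetoid X)
    (hα : 4 ≤ Fintype.card α) {A : α → α → Prop} (hsymm : ∀ u v, A u v ↔ A v u)
    (hinv : ∀ x ∈ X, ∀ u v, A (x u) (x v) ↔ A u v)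
    (hA : ∀ q : Fin 4 ↪ α, (A (q 0) (q 2) ↔ A (q 1) (q 2)) ↔ (A (q 0) (q 3) ↔ A (q 1) (q 3)))
    {x y z w : α} (hxy : x ≠ y) (hzw : z ≠ w) : A x y ↔ A z w := by
  have hA' : ∀ x y z w : α, x ≠ y → x ≠ z → x ≠ w → y ≠ z → y ≠ w →
      (A x z ↔ A y z) → (A x w ↔ A y w) := by
    intro x y z w hxy hxz hxw hyz hyw h
    by_cases hzw : z = w
    · rwa [← hzw]
    have := hA ⟨![x, y, z, w], by
      intro i j hij
      fin_cases i <;> fin_cases j <;> simp_all [Ne.symm]⟩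
    exact this.1 h
  have avoid : ∀ s : Finset α, s.card < 4 → ∃ z, z ∉ s := fun s hs => by
    by_contra! h
    have := Finset.card_le_card (show Finset.univ ⊆ s from fun z _ => h z)
    rw [Finset.card_univ] at this
    omega
  let r : Setoid α :=
    { r := fun x y => x = y ∨ ∀ z, z ≠ x → z ≠ y → (A x z ↔ A y z)
      iseqv :=
        { refl := fun x => .inl rfl
          symm := fun h => h.imp Eq.symm fun h z h1 h2 => (h z h2 h1).symm
          trans := by
            intro x y w h1 h2
            rcases h1 with rfl | h1
            · exact h2
            rcases h2 with rfl | h2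
            · exact .inr h1
            by_cases hxw : x = w
            · exact .inl hxw
            obtain ⟨t, ht⟩ := avoid {x, y, w} (Finset.card_le_three.trans_lt (by norm_num))
            simp only [Finset.mem_insert, Finset.mem_singleton, not_or] at ht
            exact .inr fun z hz1 hz2 => hA' x w t z hxw (Ne.symm ht.1) hz1.symm
              (Ne.symm ht.2.2) hz2.symm ((h1 t ht.1 ht.2.1).trans (h2 t ht.2.1 ht.2.2)) } }
  have hr : ∀ a b, a = b ∨ ∀ z, z ≠ a → z ≠ b → (A a z ↔ A b z) := by
    refine hX r (fun g hg a b h => ?_) ?_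
    · refine Or.imp (congrArg g) (fun h z h1 h2 => ?_) h
      have := h (g⁻¹ z) (fun he => h1 (by simp [← he])) (fun he => h2 (by simp [← he]))
      rwa [← hinv g hg a, ← hinv g hg b, show g (g⁻¹ z) = z by simp] at this
    · have : ∃ q : Fin 4 → α, Function.Injective q := by
        obtain ⟨q⟩ := Function.Embedding.nonempty_of_card_le (α := Fin 4) (β := α) (by simpa)
        exact ⟨q, q.injective⟩
      obtain ⟨q, hq⟩ := this
      have key : ∀ i j : Fin 4, i ≠ j → i ≠ 3 → j ≠ 3 → (A (q i) (q 3) ↔ A (q j) (q 3)) →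
          ∃ a b, a ≠ b ∧ r a b := fun i j h1 h2 h3 h =>
        ⟨q i, q j, hq.ne h1, .inr fun z hz1 hz2 => hA' _ _ _ z (hq.ne h1) (hq.ne h2) hz1.symm
          (hq.ne h3) hz2.symm h⟩
      have h01 := key 0 1 (by decide) (by decide) (by decide)
      have h12 := key 1 2 (by decide) (by decide) (by decide)
      have h02 := key 0 2 (by decide) (by decide) (by decide)
      tauto
  have hr' : ∀ a b z, z ≠ a → z ≠ b → (A a z ↔ A b z) := fun a b z h1 h2 => by
    rcases hr a b with rfl | h
    · rfl
    · exact h z h1 h2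
  by_cases hyz : y = z
  · subst hyz
    rw [hr' x w y hxy.symm hzw, hsymm]
  · rw [hr' x z y hxy.symm hyz, hsymm, hr' y w z (Ne.symm hyz) hzw, hsymm]

omit [Fintype α] in
theorem eq_and_eq_or_of_swap_eq_swap {a b c d : α} (hab : a ≠ b) (h : swap a b = swap c d) :
    a = c ∧ b = d ∨ a = d ∧ b = c := by
  have h1 := DFunLike.congr_fun h a
  rw [swap_apply_left, swap_apply_def] at h1
  split_ifs at h1 with h2 h3
  · exact .inl ⟨h2, h1⟩
  · exact .inr ⟨h3, h1⟩
  · exact absurd h1.symm hab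

omit [Fintype α] in
/-- If an element of `X` of order two exists and `X` moves `ω, y₁` not to `ω, y₂`, then the
transpositions do not form a single `X`-class. -/
theorem exists_swap_not_conj {s : Perm α} (hs : s ∈ X) (hss : s * s = 1) (hs1 : s ≠ 1)
    {ω y₁ y₂ : α} (h₂ : ω ≠ y₂)
    (h : ∀ x ∈ X, x ω = ω → x y₁ ≠ y₂) :
    ∃ u v, u ≠ v ∧ ∀ x ∈ X, swap u v ≠ x * swap ω y₁ * x⁻¹ := by
  by_contra! hcon
  obtain ⟨u, hu⟩ : ∃ u, s u ≠ u := by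
    by_contra! hu
    exact hs1 (Equiv.ext hu)
  have hsu : s (s u) = u := by rw [← Perm.mul_apply, hss, Perm.one_apply]
  have ht : ∃ t ∈ X, t ω = y₁ ∧ t y₁ = ω := by
    obtain ⟨x, hx, he⟩ := hcon u (s u) hu.symm
    rw [← swap_apply_apply] at he
    refine ⟨x⁻¹ * s * x, mul_mem (mul_mem (inv_mem hx) hs) hx, ?_⟩
    simp only [Perm.mul_apply, Perm.inv_eq_iff_eq]
    rcases eq_and_eq_or_of_swap_eq_swap hu.symm he with ⟨h1, h2⟩ | ⟨h1, h2⟩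
    · rw [← h2, ← h1, hsu]
      exact ⟨rfl, rfl⟩
    · rw [← h1, ← h2, hsu]
      exact ⟨rfl, rfl⟩
  obtain ⟨t, ht, ht1, ht2⟩ := ht
  obtain ⟨x, hx, he⟩ := hcon ω y₂ h₂
  rw [← swap_apply_apply] at he
  rcases eq_and_eq_or_of_swap_eq_swap h₂ he with ⟨h1, h2⟩ | ⟨h1, h2⟩
  · exact h x hx h1.symm h2.symm
  · refine h (x * t) (mul_mem hx ht) ?_ ?_
    · rw [Perm.mul_apply, ht1, ← h1]
    · rw [Perm.mul_apply, ht2, ← h2]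

theorem exists_classFunction_secondDifference_ne_zero (F : Type*) [Field F] [CharP F 2]
    (hX : PreservesOnlyTrivialSetoid X) (hα : 4 ≤ Fintype.card α)
    {s : Perm α} (hs : s ∈ X) (hss : s * s = 1) (hs1 : s ≠ 1)
    {ω y₁ y₂ : α} (h₁ : ω ≠ y₁) (h₂ : ω ≠ y₂) (h : ∀ x ∈ X, x ω = ω → x y₁ ≠ y₂) :
    ∃ a : Perm α → F, (∀ x ∈ X, ∀ s, a (x * s * x⁻¹) = a s) ∧ (∀ s, ¬ s.IsSwap → a s = 0) ∧
      ∃ q : Fin 4 ↪ α, a (swap (q 0) (q 2)) - a (swap (q 1) (q 2)) - a (swap (q 0) (q 3)) +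
        a (swap (q 1) (q 3)) ≠ 0 := by
  classical
  let P : Perm α → Prop := fun s => ∃ x ∈ X, s = x * swap ω y₁ * x⁻¹
  have hP : ∀ x ∈ X, ∀ s, P (x * s * x⁻¹) ↔ P s := by
    refine fun x hx s => ⟨?_, ?_⟩
    · rintro ⟨g, hg, he⟩
      refine ⟨x⁻¹ * g, mul_mem (inv_mem hx) hg, ?_⟩
      rw [show x⁻¹ * g * swap ω y₁ * (x⁻¹ * g)⁻¹ = x⁻¹ * (g * swap ω y₁ * g⁻¹) * x by group, ← he]
      group
    · rintro ⟨g, hg, rfl⟩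
      exact ⟨x * g, mul_mem hx hg, by simp only [mul_inv_rev, mul_assoc]⟩
  refine ⟨fun s => if P s then 1 else 0, fun x hx s => by simp only [hP x hx], fun s hsw => ?_, ?_⟩
  · refine if_neg ?_
    rintro ⟨x, hx, rfl⟩
    rw [← swap_apply_apply] at hsw
    exact hsw ⟨_, _, x.injective.ne h₁, rfl⟩
  · by_contra! hq
    obtain ⟨u, v, huv, hnot⟩ := exists_swap_not_conj hs hss hs1 h₂ h
    have := (forall_iff_of_forall_second_difference hX hα (A := fun u v => P (swap u v))
      (fun u v => by rw [swap_comm]) (fun x hx u v => by rw [swap_apply_apply, hP x hx])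
      (fun q => by
        have := hq q
        have h2 : (1 : F) + 1 = 0 := CharTwo.add_self_eq_zero 1
        by_cases c1 : P (swap (q 0) (q 2)) <;> by_cases c2 : P (swap (q 1) (q 2)) <;>
        by_cases c3 : P (swap (q 0) (q 3)) <;> by_cases c4 : P (swap (q 1) (q 3)) <;>
        simp only [c1, c2, c3, c4, if_true, if_false] at this ⊢ <;>
        first | tauto | simp at this)
      huv h₁).2 ⟨1, one_mem _, by simp⟩
    obtain ⟨x, hx, he⟩ := this
    exact hnot x hx he

end SecondDifference

section PrimitiveAction

variable {n m : ℕ} {X : Subgroup (alternatingGroup (Fin n))}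

open Equiv Equiv.Perm

theorem IsPrimitiveAction.preservesOnlyTrivialSetoid (hX : IsPrimitiveAction X (Fin n)) :
    PreservesOnlyTrivialSetoid (X.map (alternatingGroup (Fin n)).subtype) := by
  obtain ⟨htr, hblock⟩ := hX
  intro r hr ⟨a, b, hab, hrab⟩ c d
  have hr' : ∀ (x : X) (a b : Fin n), r a b → r (x • a) (x • b) := fun x a b h =>
    hr _ ⟨x, x.2, rfl⟩ a b h
  have hB : MulAction.IsBlock X {c | r a c} := by
    refine MulAction.isBlock_iff_smul_eq_of_mem.2 fun g b hb hgb => ?_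
    have hga : r a (g • a) := r.trans hgb (r.symm (hr' g a b hb))
    ext c
    rw [Set.mem_smul_set_iff_inv_smul_mem]
    refine ⟨fun hc => r.trans hga ?_, fun hc => ?_⟩
    · simpa using hr' g _ _ hc
    · simpa using hr' g⁻¹ _ _ (r.trans (r.symm hga) hc)
  have huniv := (hblock _ hB).resolve_left
    fun h => hab (h (r.refl a) hrab)
  have h : ∀ c, r a c := fun c => (huniv ▸ Set.mem_univ c : c ∈ {c | r a c})
  exact r.trans (r.symm (h c)) (h d)

theorem exists_mul_self_eq_one (hm : 9 ≤ m) (φ : X ≃* alternatingGroup (Fin m)) :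
    ∃ s ∈ X.map (alternatingGroup (Fin n)).subtype, s * s = 1 ∧ s ≠ 1 := by
  have hdvd : 2 ∣ Nat.card X := by
    have : Nontrivial (Fin m) := Fin.nontrivial_iff_two_le.2 (by omega)
    have h := two_mul_nat_card_alternatingGroup (α := Fin m)
    rw [Nat.card_perm, Nat.card_fin] at h
    have h4 : 2 * 2 ∣ m.factorial := Nat.dvd_factorial (by norm_num) (by omega)
    rw [Nat.card_congr φ.toEquiv]
    rw [← h] at h4
    exact Nat.dvd_of_mul_dvd_mul_left (by norm_num) h4
  obtain ⟨s, hs⟩ := exists_prime_orderOf_dvd_card' 2 hdvd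
  refine ⟨_, ⟨s, s.2, rfl⟩, ?_, ?_⟩
  · have := pow_orderOf_eq_one s
    rw [hs, sq] at this
    simp [← Subgroup.coe_mul, this]
  · intro h
    have : s = 1 := by simpa using h
    simp [this] at hs

/-- A point stabilizer of a primitive action of `A_m`, as a group of permutations of `m` points,
has large index and at least three double cosets, unless the degree is `m`. -/
theorem IsPrimitiveAction.largeNotDoublyTransitive (hX : IsPrimitiveAction X (Fin n))
    (hm : 9 ≤ m) (hmn : m < n) (φ : X ≃* alternatingGroup (Fin m)) (ω : Fin n) :
    LargeNotDoublyTransitive (((MulAction.stabilizer X ω).map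
      φ.toMonoidHom).map (alternatingGroup (Fin m)).subtype) n := by
  have : Nontrivial (Fin n) := Fin.nontrivial_iff_two_le.2 (by omega)
  have htr := hX.1
  have : MulAction.IsPreprimitive X (Fin n) := { isTrivialBlock_of_isBlock := hX.2 _ }
  have hco := MulAction.IsPreprimitive.isCoatom_stabilizer_of_isPreprimitive X ω
  set ψ : X →* Perm (Fin m) := (alternatingGroup (Fin m)).subtype.comp φ.toMonoidHom with hψ
  have hinj : Function.Injective ψ := Subtype.val_injective.comp φ.injective
  have hrange : ψ.range = alternatingGroup (Fin m) := by
    rw [hψ, MonoidHom.range_comp, MonoidHom.range_eq_top.2 φ.surjective, ← MonoidHom.range_eq_map,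
      Subgroup.range_subtype]
  rw [Subgroup.map_map, ← hψ]
  have hKA : (MulAction.stabilizer X ω).map ψ ≤ alternatingGroup (Fin m) :=
    hrange ▸ Subgroup.map_le_range _ _
  have hn : n * Nat.card ((MulAction.stabilizer X ω).map ψ) =
      Nat.card (alternatingGroup (Fin m)) := by
    rw [Nat.card_congr ((MulAction.stabilizer X ω).equivMapOfInjective ψ hinj).toEquiv.symm,
      ← Nat.card_congr φ.toEquiv, ← (MulAction.stabilizer X ω).index_mul_card,
      MulAction.index_stabilizer_of_transitive, Nat.card_fin]
  have hm' : 9 ≤ Fintype.card (Fin m) := by simpa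
  by_cases h3 : ∃ x y z, x ≠ y ∧ y ≠ z ∧ x ≠ z ∧
      threeCycle x y z ∈ (MulAction.stabilizer X ω).map ψ
  · obtain ⟨x, y, z, hxy, hyz, hxz, ht⟩ := h3
    refine largeNotDoublyTransitive_of_threeCycle_mem hm' hKA (fun h => hco.1 ?_)
      (fun L hL hLA => ?_) hn (by simpa using hmn.ne') hxy hyz hxz ht
    · rw [← hrange, MonoidHom.range_eq_map, Subgroup.map_le_map_iff_of_injective hinj] at h
      exact top_le_iff.1 h
    · have hLL : (L.comap ψ).map ψ = L := Subgroup.map_comap_eq_self (hrange ▸ hLA)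
      rcases (Subgroup.map_le_iff_le_comap.1 hL).eq_or_lt with h | h
      · exact .inl (by rw [h, hLL])
      · exact .inr (by rw [← hLL, hco.2 _ h, ← MonoidHom.range_eq_map, hrange])
  · push Not at h3
    exact largeNotDoublyTransitive_of_threeCycle_notMem hm' hKA h3 hn

theorem LargeNotDoublyTransitive.exists_ne {φ : X ≃* alternatingGroup (Fin m)} {ω : Fin n}
    (h : LargeNotDoublyTransitive (((MulAction.stabilizer X ω).map
      φ.toMonoidHom).map (alternatingGroup (Fin m)).subtype) n) :
    ∃ y₁ y₂, ω ≠ y₁ ∧ ω ≠ y₂ ∧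
      ∀ x ∈ X.map (alternatingGroup (Fin n)).subtype, x ω = ω → x y₁ ≠ y₂ := by
  obtain ⟨-, -, a, ha, b, hb, haK, hbK, hab⟩ := h
  obtain ⟨x, hx⟩ := φ.surjective ⟨a, ha⟩
  obtain ⟨y, hy⟩ := φ.surjective ⟨b, hb⟩
  have hmem : ∀ g : X, g • ω = ω → ((φ g : alternatingGroup (Fin m)) : Perm (Fin m)) ∈
      ((MulAction.stabilizer X ω).map φ.toMonoidHom).map (alternatingGroup (Fin m)).subtype :=
    fun g hg => ⟨_, ⟨g, hg, rfl⟩, rfl⟩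
  refine ⟨y • ω, x • ω, fun h => hbK ?_, fun h => haK ?_, ?_⟩
  · simpa [hy] using hmem y h.symm
  · simpa [hx] using hmem x h.symm
  · rintro _ ⟨g, hg, rfl⟩ hgω hgy
    refine hab ⟨_, hmem ⟨g, hg⟩ hgω, _, hmem ((⟨g, hg⟩ * y)⁻¹ * x) ?_, ?_⟩
    · rw [mul_smul, inv_smul_eq_iff, mul_smul]
      exact hgy.symm
    · have := congrArg Subtype.val (map_mul φ (⟨g, hg⟩ * y) ((⟨g, hg⟩ * y)⁻¹ * x))
      rw [mul_inv_cancel_left, hx, map_mul, hy] at this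
      exact this

end PrimitiveAction

theorem RepIrreducible.eq_bot_or_top_of_subgroup {F V : Type*} [Field F] [AddCommGroup V]
    [Module F V] {n : ℕ} {X : Subgroup (alternatingGroup (Fin n))}
    {ρ : Representation F (alternatingGroup (Fin n)) V} (h : RepIrreducible (ρ.comp X.subtype))
    (p : Submodule F V)
    (hp : ∀ g ∈ alternatingGroup (Fin n), ∀ v ∈ p, altRep ρ g v ∈ p) : p = ⊥ ∨ p = ⊤ :=
  h.2 p fun g v hv => by simpa [altRep_of_mem ρ g.1.2] using hp _ g.1.2 v hv

theorem RepIrreducible.eq_smul_of_commute_altRep {F V : Type*} [Field F] [IsAlgClosed F]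
    [AddCommGroup V] [Module F V] {n : ℕ} {X : Subgroup (alternatingGroup (Fin n))}
    {ρ : Representation F (alternatingGroup (Fin n)) V} (h : RepIrreducible (ρ.comp X.subtype))
    (T : Module.End F V)
    (hT : ∀ x ∈ X.map (alternatingGroup (Fin n)).subtype, Commute (altRep ρ x) T) :
    ∃ c : F, ∀ u, T u = c • u :=
  h.eq_smul_of_commute T fun g => by
    have := hT _ ⟨g, g.2, rfl⟩
    rwa [Subgroup.subtype_apply, altRep_of_mem ρ g.1.2] at this

/-- if `X ≤ Aₙ` is a primitive subgroup isomorphic to `A_m`, `n > m ≥ 9`,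
and `F` is an algebraically closed field of characteristic 2, then every
`F Aₙ`-module `V` of dimension `> 1` is reducible as an `F X`-module. -/
theorem stmt16 {F : Type*} [Field F] [IsAlgClosed F] [CharP F 2] {n m : ℕ} (hm : 9 ≤ m) (hmn : m < n)
    (X : Subgroup (alternatingGroup (Fin n)))
    (hiso : Nonempty (X ≃* alternatingGroup (Fin m)))
    (hprim : IsPrimitiveAction X (Fin n))
    (V : Type*) [AddCommGroup V] [Module F V]
    (ρ : Representation F (alternatingGroup (Fin n)) V)
    (hdim : 1 < Module.rank F V) :
    ¬ RepIrreducible (ρ.comp X.subtype) := by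
  intro hirr
  obtain ⟨φ⟩ := hiso
  have hfin := hirr.finiteDimensional
  have hV := hirr.1
  have hn : 9 ≤ Fintype.card (Fin n) := by rw [Fintype.card_fin]; omega
  have hlarge := hprim.largeNotDoublyTransitive hm hmn φ ⟨0, by omega⟩
  obtain ⟨ω, hω⟩ : ∃ ω : F, ω ^ 2 + ω + 1 = 0 := by
    obtain ⟨ω, hω⟩ := IsAlgClosed.exists_root (Polynomial.X ^ 2 + Polynomial.X + 1 : Polynomial F)
      (by rw [show (Polynomial.X ^ 2 + Polynomial.X + 1 : Polynomial F).degree = 2 by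
            compute_degree!]
          decide)
    exact ⟨ω, by simpa using hω⟩
  rcases two_pow_le_finrank_or_exists_fixed (ρ := ρ) hω hn with hd | ⟨J, v, f, hJ, hfv, h3⟩
  · rw [Fintype.card_fin] at hd
    obtain ⟨h1, h2, -⟩ := hlarge
    rw [Fintype.card_fin] at h1 h2
    have hlt := factorial_lt_of_two_pow_le hm h1 h2 hd
    have : Nontrivial (Fin m) := Fin.nontrivial_iff_two_le.2 (by omega)
    have hcard := two_mul_nat_card_alternatingGroup (α := Fin m)
    rw [Nat.card_perm, Nat.card_fin, ← Nat.card_congr φ.toEquiv] at hcard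
    have := hirr.finrank_sq_le_card
    omega
  · obtain ⟨y₁, y₂, hy₁, hy₂, hy⟩ := hlarge.exists_ne
    obtain ⟨s, hs, hss, hs1⟩ := exists_mul_self_eq_one hm φ
    obtain ⟨a, haX, ha, q, hq⟩ := exists_classFunction_secondDifference_ne_zero F
      hprim.preservesOnlyTrivialSetoid (by omega) hs hss hs1 hy₁ hy₂ hy
    have H : IsFixedPair ρ J v f := ⟨hJ, hfv, h3, hirr.eq_bot_or_top_of_subgroup⟩
    exact hdim.not_ge (H.rank_le_one (H.alternatingGroup_le_vectorStabilizer hn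
      (Subgroup.map_subtype_le X) hirr.eq_smul_of_commute_altRep haX ha hq))
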